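/- Let 0 < r < R < ∞, A > 0, d ≥ 2, and f ∈ C^{0,1}([0,A]). Then any continuous viscosity solution u of Ψ(−Δ)u = f(u) in B_R(0)∖closure(B_r(0)) with u = 0 in ℝ^d∖B_R(0), u = A in closure(B_r(0)) and 0 ≤ u ≤ A on ℝ^d is radially symmetric and strictly decreasing in the radial direction. -/

import Mathlib

open MeasureTheory Set Filter Metric Asymptotics
open scoped RealInnerProductSpace ENNReal Topology NNReal

noncomputable section

abbrev Rd (d : ℕ) := EuclideanSpace ℝ (Fin d)

/-- The data of a Bernstein function `Ψ` vanishing at `0`, its Lévy measure `𝔪`,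
and the weak scaling conditions. -/
structure PsiSetting (d : ℕ) where
  Ψ : ℝ → ℝ
  m : Measure ℝ
  m_onIoi : m (Set.Iic 0) = 0
  smooth : ContDiffOn ℝ (⊤ : ℕ∞) Ψ (Set.Ioi 0)
  nonneg : ∀ x > (0:ℝ), 0 ≤ Ψ x
  deriv_alt : ∀ n : ℕ, ∀ x > (0:ℝ),
    (-1 : ℝ) ^ (n + 1) * iteratedDerivWithin (n + 1) Ψ (Set.Ioi 0) x ≤ 0
  zero_lim : Filter.Tendsto Ψ (nhdsWithin 0 (Set.Ioi 0)) (nhds 0)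
  levy_rep : ∀ lam > (0:ℝ), Ψ lam = ∫ t, (1 - Real.exp (-lam * t)) ∂m
  a₁ : ℝ
  a₂ : ℝ
  b₁ : ℝ
  b₂ : ℝ
  ha₁ : 0 < a₁
  ha₁₂ : a₁ ≤ a₂
  ha₂ : a₂ < 1
  hb₁ : 1 ≤ b₁
  hb₂ : 1 < b₂
  scaling_lower : ∀ r R : ℝ, 1 ≤ r → r ≤ R → (1 / b₁) * (R / r) ^ a₁ ≤ Ψ R / Ψ r
  scaling_upper : ∀ r R : ℝ, 1 ≤ r → r ≤ R → Ψ R / Ψ r ≤ b₁ * (R / r) ^ a₂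

/-- The jump kernel `j(r) = ∫_0^∞ (4πt)^{-d/2} e^{-r²/(4t)} 𝔪(dt)`. -/
def PsiSetting.j {d : ℕ} (S : PsiSetting d) (r : ℝ) : ℝ :=
  ∫ t, (4 * Real.pi * t) ^ (-(d : ℝ) / 2) * Real.exp (-(r ^ 2) / (4 * t)) ∂S.m

/-- The condition `j(r) ≤ b₂ j(r+1)` for `r ≥ 1`. -/
def PsiSetting.kernelCond {d : ℕ} (S : PsiSetting d) : Prop :=
  ∀ r : ℝ, 1 ≤ r → S.j r ≤ S.b₂ * S.j (r + 1)

/-- The nonlocal operator `Ψ(−Δ)` applied to a test function. -/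
def psiOp {d : ℕ} (S : PsiSetting d) (φ : Rd d → ℝ) (x : Rd d) : ℝ :=
  ∫ z : Rd d,
    (φ x - φ (x + z) + (if ‖z‖ ≤ 1 then ⟪z, gradient φ x⟫ else 0)) * S.j ‖z‖

/-- Admissible test functions at `x`: bounded continuous and C² near `x`. -/
def TestAt {d : ℕ} (x : Rd d) (φ : Rd d → ℝ) : Prop :=
  (∃ M, ∀ y, |φ y| ≤ M) ∧ Continuous φ ∧ ∃ U ∈ nhds x, ContDiffOn ℝ 2 φ U

/-- Viscosity supersolution of `Ψ(−Δ)u + c·u = g` in `Ω`. -/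
def IsSuperSol {d : ℕ} (S : PsiSetting d) (Ω : Set (Rd d)) (c g u : Rd d → ℝ) : Prop :=
  LowerSemicontinuous u ∧
    ∀ x ∈ Ω, ∀ φ : Rd d → ℝ, TestAt x φ → φ x = u x → (∀ y, y ≠ x → φ y < u y) →
      g x ≤ psiOp S φ x + c x * u x

/-- Viscosity subsolution of `Ψ(−Δ)u + c·u = g` in `Ω`. -/
def IsSubSol {d : ℕ} (S : PsiSetting d) (Ω : Set (Rd d)) (c g u : Rd d → ℝ) : Prop :=
  UpperSemicontinuous u ∧
    ∀ x ∈ Ω, ∀ φ : Rd d → ℝ, TestAt x φ → φ x = u x → (∀ y, y ≠ x → u y < φ y) →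
      psiOp S φ x + c x * u x ≤ g x

/-- Viscosity solution of `Ψ(−Δ)u + c·u = g` in `Ω`. -/
def IsSol {d : ℕ} (S : PsiSetting d) (Ω : Set (Rd d)) (c g u : Rd d → ℝ) : Prop :=
  IsSubSol S Ω c g u ∧ IsSuperSol S Ω c g u

/-- `V` is the renewal function of the ascending ladder-height process associated with `Ψ`. -/
structure IsRenewal (Ψ V : ℝ → ℝ) : Prop where
  nonneg : ∀ x, 0 ≤ V x
  zero : ∀ x ≤ (0:ℝ), V x = 0
  cont : ContinuousOn V (Set.Ioi 0)
  mono : StrictMonoOn V (Set.Ioi 0)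
  laplace : ∀ s : ℝ, 0 < s →
    (∫ x in Set.Ioi (0 : ℝ), V x * Real.exp (-s * x)) =
      1 / (s * Real.exp ((1 / Real.pi) *
        ∫ y in Set.Ioi (0 : ℝ), Real.log (Ψ (s * y)) / (1 + y ^ 2)))

/-- `tr_V(u)(x) = t`: the `V`-trace of `u` at the boundary point `x` of `D`. -/
def HasVTrace {d : ℕ} (V : ℝ → ℝ) (D : Set (Rd d)) (u : Rd d → ℝ)
    (x : Rd d) (t : ℝ) : Prop :=
  Filter.Tendsto (fun z => u z / V (Metric.infDist z Dᶜ)) (nhdsWithin x D) (nhds t)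

/-- An open set has C² boundary. -/
def HasC2Boundary {d : ℕ} (D : Set (Rd d)) : Prop :=
  ∀ x ∈ frontier D, ∃ (U : Set (Rd d)) (f : Rd d → ℝ),
    IsOpen U ∧ x ∈ U ∧ ContDiffOn ℝ 2 f U ∧ (∀ y ∈ U, fderiv ℝ f y ≠ 0) ∧
      D ∩ U = {y ∈ U | f y < 0}

/-- A closed set has C² boundary. -/
def HasC2BoundaryClosed {d : ℕ} (G : Set (Rd d)) : Prop :=
  ∀ x ∈ frontier G, ∃ (U : Set (Rd d)) (f : Rd d → ℝ),
    IsOpen U ∧ x ∈ U ∧ ContDiffOn ℝ 2 f U ∧ (∀ y ∈ U, fderiv ℝ f y ≠ 0) ∧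
      G ∩ U = {y ∈ U | f y ≤ 0}

/-- Reflection `R_{λ,e}` across the hyperplane `{x·e = λ}`. -/
def reflAt {d : ℕ} (e : Rd d) (lam : ℝ) (x : Rd d) : Rd d :=
  x - (2 * ⟪x, e⟫ - 2 * lam) • e

/-- The open half-space `H_{λ,e} = {x·e > λ}`. -/
def halfSpace {d : ℕ} (e : Rd d) (lam : ℝ) : Set (Rd d) := {x | lam < ⟪x, e⟫}

/-- A function is antisymmetric with respect to the half-space `H_{λ,e}`. -/
def AntiSym {d : ℕ} (e : Rd d) (lam : ℝ) (u : Rd d → ℝ) : Prop :=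
  ∀ x, u x = - u (reflAt e lam x)


namespace PsiSetting

variable {d : ℕ} (S : PsiSetting d)

/-! ### The Lévy measure -/

lemma ae_pos : ∀ᵐ t ∂S.m, 0 < t := by
  have h : {t : ℝ | ¬ 0 < t} = Set.Iic 0 := by ext; simp
  rw [ae_iff, h]
  exact S.m_onIoi

lemma Ψ_ne_zero {x : ℝ} (hx : 1 ≤ x) : S.Ψ x ≠ 0 := by
  intro h0
  have h := S.scaling_lower x x hx le_rfl
  have hb := S.hb₁
  rw [h0, div_zero, div_self (by positivity), Real.one_rpow, mul_one] at h
  have : 0 < 1 / S.b₁ := by positivity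
  linarith

lemma integrable_levy : Integrable (fun t => 1 - Real.exp (-t)) S.m := by
  have h := S.levy_rep 1 one_pos
  by_contra hn
  refine S.Ψ_ne_zero le_rfl (h.trans (integral_undef ?_))
  simpa using hn

lemma min_one_le_levy {t : ℝ} (ht : 0 < t) : min 1 t / 2 ≤ 1 - Real.exp (-t) := by
  have h1 : Real.exp (-t) ≤ 1 / (1 + t) := by
    rw [Real.exp_neg, ← one_div]
    exact one_div_le_one_div_of_le (by positivity) (by linarith [Real.add_one_le_exp t])
  have h2 : min 1 t / 2 ≤ 1 - 1 / (1 + t) := by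
    have h3 : 1 - 1 / (1 + t) = t / (1 + t) := by field_simp; ring
    rw [h3, div_le_div_iff₀ (by positivity) (by positivity)]
    rcases le_total 1 t with h | h
    · rw [min_eq_left h]; linarith
    · rw [min_eq_right h]; nlinarith
  linarith

lemma integrable_min : Integrable (fun t => min 1 t) S.m := by
  refine (S.integrable_levy.const_mul 2).mono' (by fun_prop) ?_
  filter_upwards [S.ae_pos] with t ht
  rw [Real.norm_eq_abs, abs_of_nonneg (by positivity)]
  linarith [min_one_le_levy ht]

instance : SFinite S.m := by
  have h0 : ∀ᵐ t ∂S.m, ENNReal.ofReal (min 1 t) ≠ 0 := by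
    filter_upwards [S.ae_pos] with t ht
    simp [ht]
  have hm : AEMeasurable (fun t : ℝ => ENNReal.ofReal (min 1 t)) S.m := by fun_prop
  have := withDensity_inv_same₀ hm h0 (by simp)
  have hfin : IsFiniteMeasure (S.m.withDensity fun t : ℝ => ENNReal.ofReal (min 1 t)) :=
    isFiniteMeasure_withDensity_ofReal S.integrable_min.2
  rw [← this]
  infer_instance

lemma levy_univ : S.m Set.univ = ⊤ := by
  by_contra hne
  have hfin : IsFiniteMeasure S.m := ⟨lt_top_iff_ne_top.2 hne⟩
  have hbd : ∀ x, 1 ≤ x → S.Ψ x ≤ S.m.real Set.univ := by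
    intro x hx
    rw [S.levy_rep x (by linarith)]
    calc ∫ t, (1 - Real.exp (-x * t)) ∂S.m ≤ ∫ _t, (1:ℝ) ∂S.m := by
          refine integral_mono_of_nonneg ?_ (integrable_const _) ?_
          · filter_upwards [S.ae_pos] with t ht
            have : Real.exp (-x * t) ≤ 1 := Real.exp_le_one_iff.2 (by nlinarith)
            simpa using this
          · refine Eventually.of_forall fun t => ?_
            have := Real.exp_pos (-x * t)
            simp only; linarith
      _ = S.m.real Set.univ := by simp
  have hΨ : 0 < S.Ψ 1 := lt_of_le_of_ne (S.nonneg 1 one_pos) (S.Ψ_ne_zero le_rfl).symm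
  have hb := S.hb₁
  have ht : Tendsto (fun x : ℝ => (1 / S.b₁) * x ^ S.a₁ * S.Ψ 1) atTop atTop :=
    ((tendsto_rpow_atTop S.ha₁).const_mul_atTop (by positivity)).atTop_mul_const hΨ
  obtain ⟨x, hx, hx1⟩ := ((ht.eventually_gt_atTop (S.m.real Set.univ)).and
    (eventually_ge_atTop 1)).exists
  have h := S.scaling_lower 1 x le_rfl hx1
  rw [div_one, le_div_iff₀ hΨ] at h
  linarith [hbd x hx1]

/-! ### The jump kernel -/

/-- The heat kernel at time `t`, as a function of the distance `r`. -/
def heat (d : ℕ) (r t : ℝ) : ℝ :=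
  (4 * Real.pi * t) ^ (-(d : ℝ) / 2) * Real.exp (-(r ^ 2) / (4 * t))

lemma j_eq (r : ℝ) : S.j r = ∫ t, heat d r t ∂S.m := rfl

@[fun_prop]
lemma measurable_heat : Measurable (fun p : ℝ × ℝ => heat d p.1 p.2) := by
  unfold heat
  fun_prop

lemma heat_pos (r : ℝ) {t : ℝ} (ht : 0 < t) : 0 < heat d r t := by
  unfold heat
  have := Real.pi_pos
  positivity

lemma heat_lt {r s t : ℝ} (hr : 0 < r) (hrs : r < s) (ht : 0 < t) :
    heat d s t < heat d r t := by
  unfold heat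
  have := Real.pi_pos
  gcongr

lemma heat_le_of_one_le (r : ℝ) {t : ℝ} (ht : 1 ≤ t) : heat d r t ≤ 1 := by
  unfold heat
  have hpi := Real.pi_gt_three
  refine mul_le_one₀ ?_ (Real.exp_pos _).le ?_
  · refine Real.rpow_le_one_of_one_le_of_nonpos (by nlinarith) ?_
    have : (0:ℝ) ≤ d := by positivity
    linarith
  · refine Real.exp_le_one_iff.2 ?_
    rw [neg_div]
    have : 0 ≤ r ^ 2 / (4 * t) := by positivity
    linarith

lemma heat_le_of_le_one {r t : ℝ} (hr : 0 < r) (ht : 0 < t) (ht1 : t ≤ 1) :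
    heat d r t ≤ (d + 1).factorial * (4 / r ^ 2) ^ (d + 1) * t := by
  have hpi := Real.pi_gt_three
  have h1 : (4 * Real.pi * t) ^ (-(d : ℝ) / 2) ≤ t ^ (-(d : ℝ)) := by
    calc (4 * Real.pi * t) ^ (-(d : ℝ) / 2) ≤ t ^ (-(d : ℝ) / 2) := by
          refine Real.rpow_le_rpow_of_nonpos ht (by nlinarith) ?_
          have : (0:ℝ) ≤ d := by positivity
          linarith
      _ ≤ t ^ (-(d : ℝ)) := by
          refine Real.rpow_le_rpow_of_exponent_ge ht ht1 ?_
          have : (0:ℝ) ≤ d := by positivity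
          linarith
  have h2 : Real.exp (-(r ^ 2) / (4 * t)) ≤
      (d + 1).factorial * (4 / r ^ 2) ^ (d + 1) * t ^ (d + 1) := by
    have h := Real.pow_div_factorial_le_exp (r ^ 2 / (4 * t)) (by positivity) (d + 1)
    have hp : 0 < (r ^ 2 / (4 * t)) ^ (d + 1) / (d + 1).factorial := by positivity
    rw [neg_div, Real.exp_neg]
    calc (Real.exp (r ^ 2 / (4 * t)))⁻¹
        ≤ ((r ^ 2 / (4 * t)) ^ (d + 1) / (d + 1).factorial)⁻¹ := inv_anti₀ hp h
      _ = (d + 1).factorial * (4 / r ^ 2) ^ (d + 1) * t ^ (d + 1) := by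
          rw [inv_div, div_eq_mul_inv, ← inv_pow, inv_div, mul_assoc, ← mul_pow]
          congr 2
          ring
  unfold heat
  calc _ ≤ t ^ (-(d : ℝ)) * ((d + 1).factorial * (4 / r ^ 2) ^ (d + 1) * t ^ (d + 1)) := by
        gcongr
    _ = _ := by
        rw [Real.rpow_neg ht.le, Real.rpow_natCast]
        field_simp
        ring

lemma integrable_heat {r : ℝ} (hr : 0 < r) : Integrable (heat d r) S.m := by
  set C : ℝ := (d + 1).factorial * (4 / r ^ 2) ^ (d + 1) + 1
  refine (S.integrable_min.const_mul C).mono' ?_ ?_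
  · have : Measurable (heat d r) := by
      change Measurable (fun t => (fun p : ℝ × ℝ => heat d p.1 p.2) (r, t))
      exact measurable_heat.comp (by fun_prop)
    exact this.aestronglyMeasurable
  · filter_upwards [S.ae_pos] with t ht
    rw [Real.norm_eq_abs, abs_of_pos (heat_pos r ht)]
    rcases le_total t 1 with h | h
    · rw [min_eq_right h]
      have := heat_le_of_le_one (d := d) hr ht h
      simp only [C]
      linarith
    · rw [min_eq_left h]
      have := heat_le_of_one_le (d := d) r h
      have h0 : 0 ≤ ((d + 1).factorial : ℝ) * (4 / r ^ 2) ^ (d + 1) := by positivity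
      simp only [C]
      linarith

lemma integral_pos_of_ae_pos {g : ℝ → ℝ} (hg : Integrable g S.m) (h : ∀ᵐ t ∂S.m, 0 < g t) :
    0 < ∫ t, g t ∂S.m := by
  rw [integral_pos_iff_support_of_nonneg_ae (h.mono fun t ht => ht.le) hg]
  have : S.m (Function.support g) = S.m Set.univ := by
    refine measure_congr (eventuallyEq_univ.2 ?_)
    filter_upwards [h] with t ht using ht.ne'
  rw [this, S.levy_univ]
  simp

lemma j_nonneg (r : ℝ) : 0 ≤ S.j r :=
  integral_nonneg_of_ae (S.ae_pos.mono fun _ ht => (heat_pos r ht).le)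

lemma j_lt {r s : ℝ} (hr : 0 < r) (hrs : r < s) : S.j s < S.j r := by
  have h := S.integral_pos_of_ae_pos
    ((S.integrable_heat hr).sub (S.integrable_heat (hr.trans hrs)))
    (S.ae_pos.mono fun t ht => sub_pos.2 (heat_lt hr hrs ht))
  simp only [Pi.sub_apply] at h
  rw [integral_sub (S.integrable_heat hr) (S.integrable_heat (hr.trans hrs))] at h
  rw [j_eq, j_eq]
  linarith

lemma j_le {r s : ℝ} (hr : 0 < r) (hrs : r ≤ s) : S.j s ≤ S.j r := by
  rcases hrs.eq_or_lt with rfl | h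
  · exact le_rfl
  · exact (S.j_lt hr h).le

@[fun_prop]
lemma measurable_j : Measurable S.j := by
  have : StronglyMeasurable (fun r => ∫ t, heat d r t ∂S.m) :=
    StronglyMeasurable.integral_prod_right (f := fun r t => heat d r t)
      measurable_heat.stronglyMeasurable
  exact this.measurable

lemma ofReal_j {r : ℝ} (hr : 0 < r) :
    ENNReal.ofReal (S.j r) = ∫⁻ t, ENNReal.ofReal (heat d r t) ∂S.m := by
  rw [j_eq]
  exact ofReal_integral_eq_lintegral_ofReal (S.integrable_heat hr)
    (S.ae_pos.mono fun _ ht => (heat_pos r ht).le)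

lemma ae_ne_zero (hd : 2 ≤ d) : ∀ᵐ z : Rd d, z ≠ 0 := by
  have : Nonempty (Fin d) := ⟨⟨0, by omega⟩⟩
  simp [ae_iff]

/-- Tonelli for the jump kernel against a nonnegative weight. -/
lemma lintegral_mul_j (hd : 2 ≤ d) {w : Rd d → ℝ≥0∞} (hw : Measurable w) :
    ∫⁻ z : Rd d, w z * ENNReal.ofReal (S.j ‖z‖) =
      ∫⁻ t, (∫⁻ z : Rd d, w z * ENNReal.ofReal (heat d ‖z‖ t)) ∂S.m := by
  have hm : Measurable (fun p : Rd d × ℝ => w p.1 * ENNReal.ofReal (heat d ‖p.1‖ p.2)) := by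
    have : Measurable (fun p : Rd d × ℝ => heat d ‖p.1‖ p.2) :=
      measurable_heat.comp (f := fun p : Rd d × ℝ => (‖p.1‖, p.2)) (by fun_prop)
    fun_prop
  rw [← lintegral_lintegral_swap hm.aemeasurable]
  refine lintegral_congr_ae ?_
  filter_upwards [ae_ne_zero hd] with z hz
  have hmt : Measurable (fun t => heat d ‖z‖ t) :=
    measurable_heat.comp (f := fun t : ℝ => (‖z‖, t)) (by fun_prop)
  rw [S.ofReal_j (norm_pos_iff.2 hz), lintegral_const_mul _ (by fun_prop)]

lemma gaussian_integrable {b : ℝ} (hb : 0 < b) :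
    Integrable (fun z : Rd d => Real.exp (-b * ‖z‖ ^ 2)) := by
  by_contra h
  have h2 := GaussianFourier.integral_rexp_neg_mul_sq_norm (V := Rd d) hb
  rw [integral_undef h] at h2
  have := Real.pi_pos
  have : 0 < (Real.pi / b) ^ ((Module.finrank ℝ (Rd d) : ℝ) / 2) := by positivity
  linarith

lemma lintegral_gaussian {b : ℝ} (hb : 0 < b) :
    ∫⁻ z : Rd d, ENNReal.ofReal (Real.exp (-b * ‖z‖ ^ 2)) =
      ENNReal.ofReal ((Real.pi / b) ^ ((d : ℝ) / 2)) := by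
  rw [← ofReal_integral_eq_lintegral_ofReal (gaussian_integrable hb)
    (Eventually.of_forall fun _ => (Real.exp_pos _).le),
    GaussianFourier.integral_rexp_neg_mul_sq_norm hb, finrank_euclideanSpace_fin]

lemma lintegral_scaled_gaussian {t c : ℝ} (ht : 0 < t) (hc : 0 < c) :
    ∫⁻ z : Rd d, ENNReal.ofReal
      ((4 * Real.pi * t) ^ (-(d : ℝ) / 2) * Real.exp (-(1 / (4 * c * t)) * ‖z‖ ^ 2)) =
      ENNReal.ofReal (c ^ ((d : ℝ) / 2)) := by
  have hpi := Real.pi_pos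
  have h0 : 0 ≤ (4 * Real.pi * t) ^ (-(d : ℝ) / 2) := by positivity
  simp_rw [ENNReal.ofReal_mul h0]
  rw [lintegral_const_mul _ (by fun_prop), lintegral_gaussian (by positivity),
    ← ENNReal.ofReal_mul h0]
  congr 1
  have : Real.pi / (1 / (4 * c * t)) = c * (4 * Real.pi * t) := by field_simp
  rw [this, Real.mul_rpow hc.le (by positivity), neg_div, Real.rpow_neg (by positivity)]
  field_simp

lemma lintegral_heat {t : ℝ} (ht : 0 < t) :
    ∫⁻ z : Rd d, ENNReal.ofReal (heat d ‖z‖ t) = 1 := by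
  rw [← ENNReal.ofReal_one, ← Real.one_rpow ((d : ℝ) / 2),
    ← lintegral_scaled_gaussian (d := d) ht one_pos]
  congr 1; ext z
  rw [heat]
  congr 4
  field_simp

lemma sq_mul_heat_le {t : ℝ} (ht : 0 < t) (r : ℝ) :
    r ^ 2 * heat d r t ≤ 8 * t * ((4 * Real.pi * t) ^ (-(d : ℝ) / 2) *
      Real.exp (-(1 / (4 * 2 * t)) * r ^ 2)) := by
  have hpi := Real.pi_pos
  set s := r ^ 2 / (8 * t) with hs
  have h1 : r ^ 2 = 8 * t * s := by rw [hs]; field_simp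
  have h2 : Real.exp (-(r ^ 2) / (4 * t)) = Real.exp (-s) * Real.exp (-s) := by
    rw [← Real.exp_add]; congr 1; rw [h1]; field_simp; ring
  have h3 : -(1 / (4 * 2 * t)) * r ^ 2 = -s := by rw [h1]; field_simp; norm_num
  have h4 : s * Real.exp (-s) ≤ 1 := by
    have := Real.add_one_le_exp s
    rw [Real.exp_neg, ← div_eq_mul_inv, div_le_one (Real.exp_pos _)]
    linarith
  rw [heat, h2, h3]
  calc r ^ 2 * ((4 * Real.pi * t) ^ (-(d : ℝ) / 2) * (Real.exp (-s) * Real.exp (-s)))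
      = 8 * t * ((4 * Real.pi * t) ^ (-(d : ℝ) / 2) * Real.exp (-s)) * (s * Real.exp (-s)) := by
        rw [h1]; ring
    _ ≤ _ := mul_le_of_le_one_right (by positivity) h4

/-- The Lévy integrability of the jump kernel. -/
lemma integrable_min_sq_mul_j (hd : 2 ≤ d) :
    Integrable (fun z : Rd d => min 1 (‖z‖ ^ 2) * S.j ‖z‖) := by
  refine ⟨by fun_prop, ?_⟩
  have hnn : ∀ z : Rd d, 0 ≤ min 1 (‖z‖ ^ 2) * S.j ‖z‖ := fun z =>
    mul_nonneg (by positivity) (S.j_nonneg _)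
  rw [hasFiniteIntegral_iff_ofReal (Eventually.of_forall hnn)]
  have h1 : ∀ z : Rd d, ENNReal.ofReal (min 1 (‖z‖ ^ 2) * S.j ‖z‖) =
      ENNReal.ofReal (min 1 (‖z‖ ^ 2)) * ENNReal.ofReal (S.j ‖z‖) := fun z =>
    ENNReal.ofReal_mul (by positivity)
  simp_rw [h1]
  rw [S.lintegral_mul_j hd (by fun_prop)]
  set C : ℝ := 1 + 8 * 2 ^ ((d : ℝ) / 2)
  have hC : 0 ≤ C := by positivity
  have h2 : ∀ᵐ t ∂S.m, ∫⁻ z : Rd d, ENNReal.ofReal (min 1 (‖z‖ ^ 2)) *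
      ENNReal.ofReal (heat d ‖z‖ t) ≤ ENNReal.ofReal (C * min 1 t) := by
    filter_upwards [S.ae_pos] with t ht
    have hh : ∀ z : Rd d, 0 ≤ heat d ‖z‖ t := fun z => (heat_pos _ ht).le
    rcases le_total 1 t with h | h
    · rw [min_eq_left h]
      calc _ ≤ ∫⁻ z : Rd d, ENNReal.ofReal (heat d ‖z‖ t) := by
            refine lintegral_mono fun z => ?_
            refine mul_le_of_le_one_left (by positivity) ?_
            exact ENNReal.ofReal_le_one.2 (min_le_left _ _)
        _ = 1 := lintegral_heat ht
        _ ≤ _ := by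
            rw [mul_one, ENNReal.one_le_ofReal]
            simp only [C]
            have : (0:ℝ) ≤ 8 * 2 ^ ((d : ℝ) / 2) := by positivity
            linarith
    · rw [min_eq_right h]
      calc _ ≤ ∫⁻ z : Rd d, ENNReal.ofReal (8 * t) * ENNReal.ofReal
              ((4 * Real.pi * t) ^ (-(d : ℝ) / 2) *
                Real.exp (-(1 / (4 * 2 * t)) * ‖z‖ ^ 2)) := by
            refine lintegral_mono fun z => ?_
            rw [← ENNReal.ofReal_mul (by positivity), ← ENNReal.ofReal_mul (by positivity)]
            refine ENNReal.ofReal_le_ofReal (le_trans ?_ (sq_mul_heat_le ht _))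
            exact mul_le_mul_of_nonneg_right (min_le_right _ _) (hh z)
        _ = ENNReal.ofReal (8 * t) * ENNReal.ofReal (2 ^ ((d : ℝ) / 2)) := by
            rw [lintegral_const_mul _ (by fun_prop), lintegral_scaled_gaussian ht two_pos]
        _ ≤ _ := by
            rw [← ENNReal.ofReal_mul (by positivity)]
            refine ENNReal.ofReal_le_ofReal ?_
            simp only [C]
            linarith
  refine (lintegral_mono_ae h2).trans_lt ?_
  have := (S.integrable_min.const_mul C)
  exact (hasFiniteIntegral_iff_ofReal (by
    filter_upwards [S.ae_pos] with t ht
    simp only [Pi.zero_apply]; positivity)).1 this.2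

lemma lintegral_j (hd : 2 ≤ d) : ∫⁻ z : Rd d, ENNReal.ofReal (S.j ‖z‖) = ⊤ := by
  have h := S.lintegral_mul_j hd (w := fun _ => 1) measurable_const
  simp only [one_mul] at h
  rw [h, lintegral_congr_ae (g := fun _ => 1) (S.ae_pos.mono fun t ht => lintegral_heat ht)]
  simp [S.levy_univ]

lemma lintegral_j_halfSpace (hd : 2 ≤ d) (e : Rd d) (he : ‖e‖ = 1) :
    ∫⁻ z in {z : Rd d | ⟪z, e⟫ < 0}, ENNReal.ofReal (S.j ‖z‖) = ⊤ := by
  set k : Rd d → ℝ≥0∞ := fun z => ENNReal.ofReal (S.j ‖z‖)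
  have hms : MeasurableSet {z : Rd d | ⟪z, e⟫ < 0} :=
    measurableSet_lt (by fun_prop) (by fun_prop)
  have h1 : ∫⁻ z in {z : Rd d | ⟪z, e⟫ < 0}ᶜ, k z = ∫⁻ z in {z : Rd d | ⟪z, e⟫ < 0}, k z := by
    have hp := (Measure.measurePreserving_neg (volume : Measure (Rd d)))
    rw [← hp.setLIntegral_comp_preimage hms.compl (by fun_prop)]
    have hk : ∀ z, k (-z) = k z := fun z => by simp [k]
    simp_rw [hk]
    refine setLIntegral_congr ?_
    have hnull : volume {z : Rd d | ⟪z, e⟫ = 0} = 0 := by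
      have := Measure.addHaar_submodule (volume : Measure (Rd d)) (LinearMap.ker (innerₗ (Rd d) e))
        (by
          intro h
          have : e ∈ LinearMap.ker (innerₗ (Rd d) e) := h ▸ Submodule.mem_top
          simp [he] at this)
      convert this using 2
      ext z; simp [real_inner_comm]
    have hae : ∀ᵐ z : Rd d, ⟪z, e⟫ ≠ 0 := by rw [ae_iff]; simpa using hnull
    filter_upwards [hae] with z hz
    apply propext
    change (¬ (⟪-z, e⟫ < 0)) ↔ ⟪z, e⟫ < 0
    rw [inner_neg_left]
    constructor
    · intro h; exact lt_of_le_of_ne (by linarith) hz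
    · intro h; linarith
  by_contra hne
  have h2 := lintegral_add_compl k hms (μ := volume)
  rw [h1, S.lintegral_j hd] at h2
  exact (ENNReal.add_ne_top.2 ⟨hne, hne⟩) h2

end PsiSetting

/-! ### Truncated operators at touching points -/

section Truncation

variable {d : ℕ} {S : PsiSetting d}

lemma integrable_mul_j (hd : 2 ≤ d) {F : Rd d → ℝ} (hF : Measurable F) {K : ℝ}
    (hK : ∀ z, |F z| ≤ K * min 1 (‖z‖ ^ 2)) : Integrable (fun z => F z * S.j ‖z‖) := by
  refine ((S.integrable_min_sq_mul_j hd).const_mul K).mono' (by fun_prop) ?_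
  refine Eventually.of_forall fun z => ?_
  rw [Real.norm_eq_abs, abs_mul, abs_of_nonneg (S.j_nonneg _), ← mul_assoc]
  exact mul_le_mul_of_nonneg_right (hK z) (S.j_nonneg _)

lemma measurableSet_far (ρ : ℝ) : MeasurableSet {z : Rd d | ρ ≤ ‖z‖} :=
  measurableSet_le (by fun_prop) (by fun_prop)

lemma measurableSet_near (ρ : ℝ) : MeasurableSet {z : Rd d | ‖z‖ < ρ} :=
  measurableSet_lt (by fun_prop) (by fun_prop)

lemma compl_far (ρ : ℝ) : {z : Rd d | ρ ≤ ‖z‖}ᶜ = {z : Rd d | ‖z‖ < ρ} := by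
  ext; simp

lemma le_min_one_sq {ρ s : ℝ} (hρ : 0 < ρ) (hρ1 : ρ ≤ 1) (hs : ρ ≤ s) :
    ρ ^ 2 ≤ min 1 (s ^ 2) :=
  le_min (by nlinarith) (by nlinarith)

lemma integrableOn_far (hd : 2 ≤ d) {F : Rd d → ℝ} (hF : Measurable F) {K ρ : ℝ}
    (hρ : 0 < ρ) (hρ1 : ρ ≤ 1) (hK : ∀ z, |F z| ≤ K) :
    IntegrableOn (fun z => F z * S.j ‖z‖) {z | ρ ≤ ‖z‖} := by
  have hK0 : 0 ≤ K := (abs_nonneg _).trans (hK 0)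
  have h := integrable_mul_j (S := S) hd (F := {z : Rd d | ρ ≤ ‖z‖}.indicator F)
    (hF.indicator (measurableSet_far ρ)) (K := K / ρ ^ 2) (fun z => by
      by_cases hz : ρ ≤ ‖z‖
      · rw [indicator_of_mem (by exact hz), div_mul_eq_mul_div, le_div_iff₀ (by positivity)]
        exact mul_le_mul (hK z) (le_min_one_sq hρ hρ1 hz) (by positivity) hK0
      · rw [indicator_of_notMem (by exact hz), abs_zero]
        positivity)
  rw [← integrable_indicator_iff (measurableSet_far ρ)]
  refine h.congr (Eventually.of_forall fun z => ?_)
  by_cases hz : ρ ≤ ‖z‖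
  · simp [indicator_of_mem (show z ∈ {z : Rd d | ρ ≤ ‖z‖} from hz)]
  · simp [indicator_of_notMem (show z ∉ {z : Rd d | ρ ≤ ‖z‖} from hz)]

lemma integrableOn_near (hd : 2 ≤ d) {δ : ℝ} (hδ1 : δ ≤ 1) :
    IntegrableOn (fun z : Rd d => ‖z‖ ^ 2 * S.j ‖z‖) {z | ‖z‖ < δ} := by
  refine (S.integrable_min_sq_mul_j hd).integrableOn.congr_fun (fun z hz => ?_)
    (measurableSet_near δ)
  have h1 : ‖z‖ < δ := hz
  have h2 : ‖z‖ ^ 2 ≤ 1 := by nlinarith [norm_nonneg z]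
  simp [min_eq_right h2]

/-- The increment of `u` at `x`, compensated by the slope `p` for small jumps. -/
def increment (u : Rd d → ℝ) (x p z : Rd d) : ℝ :=
  u x - u (x + z) + if ‖z‖ ≤ 1 then ⟪z, p⟫ else 0

lemma measurable_increment {u : Rd d → ℝ} (hu : Continuous u) (x p : Rd d) :
    Measurable (increment u x p) := by
  have h : Measurable fun z : Rd d => if ‖z‖ ≤ 1 then ⟪z, p⟫ else (0 : ℝ) :=
    Measurable.ite (measurableSet_le (by fun_prop) (by fun_prop)) (by fun_prop) (by fun_prop)
  have h2 : Measurable fun z => u (x + z) := (by fun_prop : Continuous _).measurable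
  exact (measurable_const.sub h2).add h

lemma abs_increment_le {u : Rd d → ℝ} {M : ℝ} (hM : ∀ y, |u y| ≤ M) (x p z : Rd d) :
    |increment u x p z| ≤ 2 * M + ‖p‖ := by
  have h1 := abs_le.1 (hM x)
  have h2 := abs_le.1 (hM (x + z))
  have h3 : |if ‖z‖ ≤ 1 then ⟪z, p⟫ else (0:ℝ)| ≤ ‖p‖ := by
    split_ifs with h
    · calc |⟪z, p⟫| ≤ ‖z‖ * ‖p‖ := abs_real_inner_le_norm z p
        _ ≤ 1 * ‖p‖ := by gcongr
        _ = ‖p‖ := one_mul _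
    · simp
  have h4 := abs_le.1 h3
  rw [increment, abs_le]
  constructor <;> linarith

/-- `u` is a subsolution with right-hand side `g` at `x`, tested with paraboloids which are
only used on a small ball. -/
def TruncSub (S : PsiSetting d) (u g : Rd d → ℝ) (x : Rd d) : Prop :=
  ∀ (p : Rd d) (C δ : ℝ), 0 ≤ C → 0 < δ → δ ≤ 1 →
    (∀ z : Rd d, ‖z‖ ≤ δ → u (x + z) ≤ u x + ⟪z, p⟫ + C * ‖z‖ ^ 2) →
    ∫ z in {z | δ ≤ ‖z‖}, increment u x p z * S.j ‖z‖ ≤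
      g x + C * ∫ z in {z : Rd d | ‖z‖ < δ}, ‖z‖ ^ 2 * S.j ‖z‖

section TestFunction

variable (u : Rd d → ℝ) (x p : Rd d) (C τ : ℝ) (χ : ContDiffBump x)

/-- The paraboloid touching `u` at `x`. -/
def paraboloid (y : Rd d) : ℝ := u x + ⟪y - x, p⟫ + C * ‖y - x‖ ^ 2

/-- A bounded smooth function with a strict minimum at `x`. -/
def dimple (y : Rd d) : ℝ := ‖y - x‖ ^ 2 / (1 + ‖y - x‖ ^ 2)

/-- The paraboloid glued to `u` and lifted slightly away from `x`. -/
def gluedTest (y : Rd d) : ℝ :=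
  χ y * paraboloid u x p C y + (1 - χ y) * u y + τ * dimple x y

variable {x} in
lemma dimple_nonneg (y : Rd d) : 0 ≤ dimple x y := by unfold dimple; positivity

lemma dimple_le (z : Rd d) : dimple x (x + z) ≤ min 1 (‖z‖ ^ 2) := by
  simp only [dimple, add_sub_cancel_left]
  have h : 0 ≤ ‖z‖ ^ 2 := by positivity
  refine le_min ((div_le_one (by positivity)).2 (by linarith)) ?_
  exact div_le_self h (by linarith)

lemma contDiff_dimple : ContDiff ℝ 2 (dimple x) := by
  unfold dimple
  have h : ContDiff ℝ 2 fun y : Rd d => ‖y - x‖ ^ 2 := (contDiff_id.sub contDiff_const).norm_sq ℝ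
  exact h.div (contDiff_const.add h) fun y => by positivity

lemma contDiff_paraboloid : ContDiff ℝ 2 (paraboloid u x p C) := by
  unfold paraboloid
  have h0 : ContDiff ℝ 2 fun y : Rd d => y - x := contDiff_id.sub contDiff_const
  exact (contDiff_const.add (h0.inner ℝ contDiff_const)).add
    (contDiff_const.mul (h0.norm_sq ℝ))

lemma gluedTest_eventuallyEq :
    gluedTest u x p C τ χ =ᶠ[𝓝 x] fun y => paraboloid u x p C y + τ * dimple x y := by
  filter_upwards [closedBall_mem_nhds x χ.rIn_pos] with y hy
  simp [gluedTest, χ.one_of_mem_closedBall hy]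

lemma gluedTest_self : gluedTest u x p C τ χ x = u x := by
  rw [(gluedTest_eventuallyEq u x p C τ χ).self_of_nhds]
  simp [paraboloid, dimple]

lemma gradient_gluedTest (hC : 0 ≤ C) (hτ : 0 ≤ τ) : gradient (gluedTest u x p C τ χ) x = p := by
  refine HasGradientAt.gradient ?_
  rw [hasGradientAt_iff_hasFDerivAt]
  refine HasFDerivAt.congr_of_eventuallyEq ?_ (gluedTest_eventuallyEq u x p C τ χ)
  have h1 : HasFDerivAt (fun y : Rd d => u x + ⟪y - x, p⟫)
      (InnerProductSpace.toDual ℝ (Rd d) p) x := by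
    have : HasFDerivAt (fun y : Rd d => u x + (InnerProductSpace.toDual ℝ (Rd d) p) (y - x))
        (InnerProductSpace.toDual ℝ (Rd d) p) x :=
      (((InnerProductSpace.toDual ℝ (Rd d) p).hasFDerivAt).comp x
        ((hasFDerivAt_id x).sub_const x)).const_add (u x)
    simpa [real_inner_comm] using this
  have h2 : HasFDerivAt (fun y : Rd d => C * ‖y - x‖ ^ 2 + τ * dimple x y)
      (0 : Rd d →L[ℝ] ℝ) x := by
    suffices hO : (fun y : Rd d => C * ‖y - x‖ ^ 2 + τ * dimple x y) =O[𝓝 x]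
        fun y => ‖y - x‖ ^ 2 from hO.hasFDerivAt one_lt_two
    refine Asymptotics.IsBigO.of_bound (C + τ) (Eventually.of_forall fun y => ?_)
    have hb := (dimple_le x (y - x)).trans (min_le_right _ _)
    rw [add_sub_cancel] at hb
    have hb0 := dimple_nonneg (x := x) y
    rw [Real.norm_eq_abs, abs_of_nonneg (by positivity), Real.norm_eq_abs,
      abs_of_nonneg (by positivity)]
    nlinarith
  have h3 := h1.add h2
  rw [add_zero] at h3
  refine h3.congr_of_eventuallyEq (Eventually.of_forall fun y => ?_)
  simp only [paraboloid, Pi.add_apply]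
  ring

variable {u x p C τ χ}

lemma continuous_gluedTest (hu : Continuous u) : Continuous (gluedTest u x p C τ χ) := by
  unfold gluedTest
  have h1 := (contDiff_dimple x).continuous
  have h2 := (contDiff_paraboloid u x p C).continuous
  have h3 : Continuous χ := χ.continuous
  fun_prop

lemma exists_abs_gluedTest_le {M : ℝ} (hM : ∀ y, |u y| ≤ M) (hC : 0 ≤ C) (hτ : 0 ≤ τ) :
    ∃ K, ∀ y, |gluedTest u x p C τ χ y| ≤ K := by
  refine ⟨(M + χ.rOut * ‖p‖ + C * χ.rOut ^ 2) + M + τ, fun y => ?_⟩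
  have hM0 : 0 ≤ M := (abs_nonneg _).trans (hM x)
  have hr := χ.rOut_pos
  have h1 : |χ y * paraboloid u x p C y| ≤ M + χ.rOut * ‖p‖ + C * χ.rOut ^ 2 := by
    by_cases hy : y ∈ ball x χ.rOut
    · have hy' : ‖y - x‖ ≤ χ.rOut := (mem_ball_iff_norm.1 hy).le
      rw [abs_mul, abs_of_nonneg χ.nonneg]
      calc χ y * |paraboloid u x p C y| ≤ 1 * |paraboloid u x p C y| := by
            gcongr; exact χ.le_one
        _ ≤ |u x| + |⟪y - x, p⟫| + |C * ‖y - x‖ ^ 2| := by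
            rw [one_mul]; exact abs_add_three _ _ _
        _ ≤ _ := by
            rw [abs_of_nonneg (by positivity : 0 ≤ C * ‖y - x‖ ^ 2)]
            have := (abs_real_inner_le_norm (y - x) p).trans
              (mul_le_mul_of_nonneg_right hy' (norm_nonneg p))
            have := hM x
            gcongr
    · have : χ y = 0 := by
        rw [← Function.notMem_support, χ.support_eq]; exact hy
      rw [this, zero_mul, abs_zero]
      positivity
  have h2 : |(1 - χ y) * u y| ≤ M := by
    have h0 := χ.nonneg (x := y)
    have h1 := χ.le_one (x := y)
    rw [abs_mul, abs_of_nonneg (by linarith)]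
    calc (1 - χ y) * |u y| ≤ 1 * M :=
          mul_le_mul (by linarith) (hM y) (abs_nonneg _) zero_le_one
      _ = M := one_mul M
  have h3 : |τ * dimple x y| ≤ τ := by
    have := (dimple_le x (y - x)).trans (min_le_left _ _)
    rw [add_sub_cancel] at this
    rw [abs_of_nonneg (mul_nonneg hτ (dimple_nonneg y))]
    exact mul_le_of_le_one_right hτ this
  exact (abs_add_three _ _ _).trans (by linarith)

lemma gluedTest_le_of_near
    (hq : ∀ z, ‖z‖ ≤ χ.rOut → u (x + z) ≤ u x + ⟪z, p⟫ + C * ‖z‖ ^ 2) {z : Rd d}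
    (hz : ‖z‖ ≤ χ.rOut) :
    gluedTest u x p C τ χ (x + z) ≤ u x + ⟪z, p⟫ + C * ‖z‖ ^ 2 + τ * dimple x (x + z) := by
  have h0 := χ.le_one (x := x + z)
  have h1 := hq z hz
  simp only [gluedTest, paraboloid, add_sub_cancel_left]
  nlinarith

lemma gluedTest_of_far {z : Rd d} (hz : χ.rOut ≤ ‖z‖) :
    gluedTest u x p C τ χ (x + z) = u (x + z) + τ * dimple x (x + z) := by
  have : χ (x + z) = 0 := by
    rw [← Function.notMem_support, χ.support_eq]
    simpa using hz
  simp [gluedTest, this]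

lemma lt_gluedTest (hτ : 0 < τ)
    (hq : ∀ z, ‖z‖ ≤ χ.rOut → u (x + z) ≤ u x + ⟪z, p⟫ + C * ‖z‖ ^ 2) {y : Rd d} (hy : y ≠ x) :
    u y < gluedTest u x p C τ χ y := by
  have hpos : 0 < τ * dimple x y := by
    have : 0 < ‖y - x‖ := norm_pos_iff.2 (sub_ne_zero.2 hy)
    unfold dimple; positivity
  by_cases h : ‖y - x‖ ≤ χ.rOut
  · have h1 := hq _ h
    rw [add_sub_cancel] at h1
    have h0 := χ.nonneg (x := y)
    simp only [gluedTest, paraboloid]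
    nlinarith
  · have h1 := gluedTest_of_far (u := u) (p := p) (C := C) (τ := τ) (not_le.1 h).le
    rw [add_sub_cancel] at h1
    rw [h1]; linarith

lemma testAt_gluedTest {M : ℝ} (hu : Continuous u) (hM : ∀ y, |u y| ≤ M) (hC : 0 ≤ C)
    (hτ : 0 ≤ τ) : TestAt x (gluedTest u x p C τ χ) := by
  refine ⟨exists_abs_gluedTest_le hM hC hτ, continuous_gluedTest hu, ?_⟩
  refine ⟨_, gluedTest_eventuallyEq u x p C τ χ, ContDiffOn.congr
    (((contDiff_paraboloid u x p C).add (contDiff_const.mul (contDiff_dimple x))).contDiffOn)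
    fun y hy => hy⟩

lemma integrable_increment_gluedTest (hd : 2 ≤ d) {M : ℝ} (hu : Continuous u)
    (hM : ∀ y, |u y| ≤ M) (hC : 0 ≤ C) (hτ : 0 ≤ τ) (hχ : χ.rIn ≤ 1) :
    Integrable fun z => increment (gluedTest u x p C τ χ) x p z * S.j ‖z‖ := by
  obtain ⟨K, hK⟩ := exists_abs_gluedTest_le (x := x) (p := p) (χ := χ) hM hC hτ
  have hr := χ.rIn_pos
  set K' := 2 * K + ‖p‖
  have hK' : 0 ≤ K' := (abs_nonneg _).trans (abs_increment_le hK x p 0)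
  refine integrable_mul_j hd (measurable_increment (continuous_gluedTest hu) x p)
    (K := (C + τ) + K' / χ.rIn ^ 2) fun z => ?_
  rcases le_total ‖z‖ χ.rIn with hz | hz
  · have h1 : min 1 (‖z‖ ^ 2) = ‖z‖ ^ 2 := min_eq_right (by nlinarith [norm_nonneg z])
    have hone : χ (x + z) = 1 := χ.one_of_mem_closedBall (by simpa using hz)
    have h2 : increment (gluedTest u x p C τ χ) x p z =
        -(C * ‖z‖ ^ 2 + τ * dimple x (x + z)) := by
      rw [increment, gluedTest_self, if_pos (hz.trans hχ)]
      simp only [gluedTest, hone, paraboloid, add_sub_cancel_left]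
      ring
    have h3 := dimple_le x z
    rw [h1] at h3 ⊢
    rw [h2, abs_neg, abs_of_nonneg
      (add_nonneg (by positivity) (mul_nonneg hτ (dimple_nonneg _)))]
    have h4 : 0 ≤ K' / χ.rIn ^ 2 * ‖z‖ ^ 2 := by positivity
    nlinarith
  · have h1 := le_min_one_sq hr hχ hz
    calc _ ≤ K' := abs_increment_le hK x p z
      _ = K' / χ.rIn ^ 2 * χ.rIn ^ 2 := by field_simp
      _ ≤ K' / χ.rIn ^ 2 * min 1 (‖z‖ ^ 2) := by gcongr
      _ ≤ _ := by
        gcongr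
        linarith

end TestFunction

lemma IsSubSol.truncSub (hd : 2 ≤ d) {Ω : Set (Rd d)} {g u : Rd d → ℝ}
    (h : IsSubSol S Ω (fun _ => 0) g u) (hu : Continuous u) {M : ℝ} (hM : ∀ y, |u y| ≤ M)
    {x : Rd d} (hx : x ∈ Ω) : TruncSub S u g x := by
  intro p C δ hC hδ hδ1 hq
  let χ : ContDiffBump x := ⟨δ / 2, δ, by positivity, by linarith⟩
  set I : ℝ := ∫ z : Rd d, min 1 (‖z‖ ^ 2) * S.j ‖z‖
  have hI : 0 ≤ I := integral_nonneg fun z => mul_nonneg (by positivity) (S.j_nonneg _)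
  have key : ∀ τ > 0, ∫ z in {z | δ ≤ ‖z‖}, increment u x p z * S.j ‖z‖ ≤
      g x + C * (∫ z in {z : Rd d | ‖z‖ < δ}, ‖z‖ ^ 2 * S.j ‖z‖) + τ * I := by
    intro τ hτ
    set φ := gluedTest u x p C τ χ with hφ
    have h1 := h.2 x hx φ (testAt_gluedTest hu hM hC hτ.le) (gluedTest_self u x p C τ χ)
      (fun y hy => lt_gluedTest hτ hq hy)
    simp only [psiOp, hφ, gradient_gluedTest u x p C τ χ hC hτ.le, zero_mul, add_zero] at h1
    have hint := integrable_increment_gluedTest (S := S) (u := u) (x := x) (p := p) (χ := χ)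
      hd hu hM hC hτ.le (show δ / 2 ≤ 1 by linarith)
    have hmin := S.integrable_min_sq_mul_j hd
    have hsplit := integral_add_compl (measurableSet_far δ) hint
    have hsplit' := integral_add_compl (measurableSet_far δ) hmin
    rw [compl_far] at hsplit hsplit'
    have hfar : (∫ z in {z | δ ≤ ‖z‖}, increment u x p z * S.j ‖z‖) -
        τ * (∫ z in {z : Rd d | δ ≤ ‖z‖}, min 1 (‖z‖ ^ 2) * S.j ‖z‖) ≤
        ∫ z in {z | δ ≤ ‖z‖}, increment φ x p z * S.j ‖z‖ := by
      rw [← integral_const_mul, ← integral_sub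
        (integrableOn_far hd (measurable_increment hu x p) hδ hδ1 (abs_increment_le hM x p))
        (hmin.integrableOn.const_mul τ)]
      refine setIntegral_mono_on ((integrableOn_far hd (measurable_increment hu x p) hδ hδ1
        (abs_increment_le hM x p)).sub (hmin.integrableOn.const_mul τ)) hint.integrableOn
        (measurableSet_far δ) fun z hz => ?_
      rw [← mul_assoc, ← sub_mul]
      refine mul_le_mul_of_nonneg_right ?_ (S.j_nonneg _)
      rw [increment, increment, hφ, gluedTest_self, gluedTest_of_far (show χ.rOut ≤ ‖z‖ from hz)]
      nlinarith [dimple_le x z]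
    have hnear : -(C * (∫ z in {z : Rd d | ‖z‖ < δ}, ‖z‖ ^ 2 * S.j ‖z‖)) -
        τ * (∫ z in {z : Rd d | ‖z‖ < δ}, min 1 (‖z‖ ^ 2) * S.j ‖z‖) ≤
        ∫ z in {z | ‖z‖ < δ}, increment φ x p z * S.j ‖z‖ := by
      have i1 := (integrableOn_near (S := S) hd hδ1).const_mul (-C)
      have i2 := (hmin.integrableOn (s := {z : Rd d | ‖z‖ < δ})).const_mul τ
      rw [← neg_mul, ← integral_const_mul, ← integral_const_mul, ← integral_sub i1 i2]
      refine setIntegral_mono_on (i1.sub i2) hint.integrableOn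
        (measurableSet_near δ) fun z hz => ?_
      have hz' : ‖z‖ < δ := hz
      rw [← mul_assoc, ← mul_assoc, ← sub_mul]
      refine mul_le_mul_of_nonneg_right ?_ (S.j_nonneg _)
      rw [increment, hφ, gluedTest_self, if_pos (hz'.le.trans hδ1)]
      have := gluedTest_le_of_near (χ := χ) (τ := τ) hq hz'.le
      nlinarith [dimple_le x z]
    have h1' : ∫ z, increment φ x p z * S.j ‖z‖ ≤ g x := h1
    have hIeq : τ * I = τ * (∫ z in {z : Rd d | δ ≤ ‖z‖}, min 1 (‖z‖ ^ 2) * S.j ‖z‖) +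
        τ * ∫ z in {z : Rd d | ‖z‖ < δ}, min 1 (‖z‖ ^ 2) * S.j ‖z‖ := by
      rw [← mul_add, hsplit']
    rw [← hφ] at hsplit
    linarith
  refine le_of_forall_pos_le_add fun ε hε => ?_
  refine (key (ε / (I + 1)) (by positivity)).trans ?_
  have : ε / (I + 1) * I ≤ ε := by
    rw [div_mul_eq_mul_div, div_le_iff₀ (by positivity)]
    nlinarith
  linarith

lemma gradient_fun_neg (φ : Rd d → ℝ) (x : Rd d) :
    gradient (fun y => -φ y) x = -gradient φ x := by
  simp only [gradient]
  rw [fderiv_fun_neg, map_neg]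

lemma psiOp_neg (φ : Rd d → ℝ) (x : Rd d) : psiOp S (fun y => -φ y) x = -psiOp S φ x := by
  simp only [psiOp, gradient_fun_neg, ← integral_neg]
  congr 1; ext z
  rw [inner_neg_right]
  split_ifs <;> ring

lemma IsSuperSol.neg {Ω : Set (Rd d)} {g u : Rd d → ℝ}
    (h : IsSuperSol S Ω (fun _ => 0) g u) :
    IsSubSol S Ω (fun _ => 0) (fun x => -g x) (fun x => -u x) := by
  refine ⟨?_, fun x hx φ hφ h0 hlt => ?_⟩
  · intro x y hy
    have := h.1 x (-y) (by linarith)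
    filter_upwards [this] with z hz
    linarith
  · have := h.2 x hx (fun y => -φ y) ?_ (by linarith) (fun y hy => by linarith [hlt y hy])
    · rw [psiOp_neg] at this
      linarith
    · obtain ⟨⟨M, hM⟩, hc, U, hU, hφU⟩ := hφ
      exact ⟨⟨M, fun y => by rw [abs_neg]; exact hM y⟩, hc.neg, U, hU, hφU.neg⟩

end Truncation

/-! ### Doubling of variables -/

section Doubling

variable {d : ℕ} {S : PsiSetting d}

lemma exists_near_lt (hd : 2 ≤ d) {ρ ε : ℝ} (hρ : 0 < ρ) (hρ1 : ρ ≤ 1) (hε : 0 < ε) :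
    ∃ δ, 0 < δ ∧ δ ≤ ρ ∧ ∫ z in {z : Rd d | ‖z‖ < δ}, ‖z‖ ^ 2 * S.j ‖z‖ < ε := by
  have hle : ∀ k : ℕ, ρ / (k + 1) ≤ ρ := fun k => div_le_self hρ.le (by simp)
  have h := tendsto_setIntegral_of_antitone (μ := volume)
    (f := fun z : Rd d => ‖z‖ ^ 2 * S.j ‖z‖) (s := fun k : ℕ => {z : Rd d | ‖z‖ < ρ / (k + 1)})
    (fun k => measurableSet_near _)
    (fun k l hkl z hz => lt_of_lt_of_le (show ‖z‖ < _ from hz) (by gcongr))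
    ⟨0, integrableOn_near hd ((hle 0).trans hρ1)⟩
  have h0 : ∫ z in ⋂ k : ℕ, {z : Rd d | ‖z‖ < ρ / (k + 1)}, ‖z‖ ^ 2 * S.j ‖z‖ = 0 := by
    refine setIntegral_eq_zero_of_forall_eq_zero fun z hz => ?_
    rw [mem_iInter] at hz
    have ht : Tendsto (fun k : ℕ => ρ / ((k : ℝ) + 1)) atTop (𝓝 0) := by
      simpa [div_eq_mul_inv] using tendsto_one_div_add_atTop_nhds_zero_nat.const_mul ρ
    have : ‖z‖ ≤ 0 := ge_of_tendsto' ht fun k => (hz k).le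
    have : ‖z‖ = 0 := le_antisymm this (norm_nonneg z)
    simp [this]
  rw [h0] at h
  obtain ⟨k, hk⟩ := (h.eventually_lt_const hε).exists
  exact ⟨ρ / (k + 1), by positivity, hle k, hk⟩

lemma norm_add_sub_sq (a b z : Rd d) :
    ‖a + z - b‖ ^ 2 = ‖a - b‖ ^ 2 + 2 * ⟪z, a - b⟫ + ‖z‖ ^ 2 := by
  have : a + z - b = (a - b) + z := by abel
  rw [this, norm_add_sq_real, real_inner_comm]

/-- The increment of `(x, y) ↦ u x + v y` along the diagonal, compensated by the slope `p`. -/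
def jointIncrement (u v : Rd d → ℝ) (x y p z : Rd d) : ℝ :=
  u x + v y - u (x + z) - v (y + z) + if ‖z‖ ≤ 1 then ⟪z, p⟫ else 0

lemma jointIncrement_eq (u v : Rd d → ℝ) (x y p q z : Rd d) :
    jointIncrement u v x y (p + q) z = increment u x p z + increment v y q z := by
  unfold jointIncrement increment
  rw [inner_add_right]
  split_ifs <;> ring

lemma measurable_jointIncrement {u v : Rd d → ℝ} (hu : Continuous u) (hv : Continuous v)
    (x y p : Rd d) : Measurable (jointIncrement u v x y p) := by
  have h := (measurable_increment hu x p).add (measurable_increment hv y 0)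
  have h2 : jointIncrement u v x y p = fun z => increment u x p z + increment v y 0 z := by
    ext z; rw [← jointIncrement_eq, add_zero]
  rw [h2]; exact h

lemma abs_jointIncrement_le {u v : Rd d → ℝ} {M : ℝ} (huM : ∀ y, |u y| ≤ M)
    (hvM : ∀ y, |v y| ≤ M) (x y p z : Rd d) : |jointIncrement u v x y p z| ≤ 4 * M + ‖p‖ := by
  have h : jointIncrement u v x y p z = increment u x p z + increment v y 0 z := by
    rw [← jointIncrement_eq, add_zero]
  rw [h]
  refine (abs_add_le _ _).trans ?_
  have h1 := abs_increment_le huM x p z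
  have h2 := abs_increment_le hvM y 0 z
  rw [norm_zero] at h2
  linarith

/-- The doubled functional, penalising both the distance of the variables to each other and the
distance to `x₀`. -/
def doubled (u v : Rd d → ℝ) (x₀ : Rd d) (κ N : ℝ) (q : Rd d × Rd d) : ℝ :=
  u q.1 + v q.2 - κ * ‖q.1 - x₀‖ ^ 2 - N * ‖q.1 - q.2‖ ^ 2

lemma far_integral_le_of_doubled_max (hd : 2 ≤ d) {u v g h : Rd d → ℝ} (hu : Continuous u)
    (hv : Continuous v) {M : ℝ} (huM : ∀ y, |u y| ≤ M) (hvM : ∀ y, |v y| ≤ M) {x₀ x y : Rd d}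
    {κ N ρ : ℝ} (hκ : 0 ≤ κ) (hN : 0 ≤ N) (hρ : 0 < ρ) (hρ1 : ρ ≤ 1)
    (h1 : TruncSub S u g x) (h2 : TruncSub S v h y)
    (hmax : ∀ a b : Rd d, ‖a‖ ≤ ρ → ‖b‖ ≤ ρ →
      doubled u v x₀ κ N (x + a, y + b) ≤ doubled u v x₀ κ N (x, y)) :
    ∫ z in {z | ρ ≤ ‖z‖}, jointIncrement u v x y ((2 * κ) • (x - x₀)) z * S.j ‖z‖ ≤
      g x + h y + κ * ∫ z : Rd d, min 1 (‖z‖ ^ 2) * S.j ‖z‖ := by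
  set p₁ : Rd d := (2 * κ) • (x - x₀) + (2 * N) • (x - y) with hp₁
  set p₂ : Rd d := -((2 * N) • (x - y)) with hp₂
  have hsum : p₁ + p₂ = (2 * κ) • (x - x₀) := by rw [hp₁, hp₂]; abel
  have hmin := S.integrable_min_sq_mul_j hd
  have hmin0 : ∀ z : Rd d, 0 ≤ min 1 (‖z‖ ^ 2) * S.j ‖z‖ := fun z =>
    mul_nonneg (by positivity) (S.j_nonneg _)
  have hq₁ : ∀ z : Rd d, ‖z‖ ≤ ρ → u (x + z) ≤ u x + ⟪z, p₁⟫ + (κ + N) * ‖z‖ ^ 2 := by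
    intro z hz
    have := hmax z 0 hz (by simpa using hρ.le)
    simp only [doubled, add_zero, norm_add_sub_sq] at this
    rw [hp₁, inner_add_right, inner_smul_right, inner_smul_right]
    linarith
  have hq₂ : ∀ z : Rd d, ‖z‖ ≤ ρ → v (y + z) ≤ v y + ⟪z, p₂⟫ + N * ‖z‖ ^ 2 := by
    intro z hz
    have := hmax 0 z (by simpa using hρ.le) hz
    simp only [doubled, add_zero, norm_sub_rev x, norm_add_sub_sq] at this
    have h3 : ⟪z, y - x⟫ = -⟪z, x - y⟫ := by rw [← inner_neg_right, neg_sub]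
    rw [h3] at this
    rw [hp₂, inner_neg_right, inner_smul_right]
    linarith
  have hD : ∀ z : Rd d, ‖z‖ ≤ ρ →
      -(κ * min 1 (‖z‖ ^ 2)) ≤ jointIncrement u v x y (p₁ + p₂) z := by
    intro z hz
    have h3 := hmax z z hz hz
    have h4 : x + z - (y + z) = x - y := by abel
    simp only [doubled, norm_add_sub_sq x x₀, h4] at h3
    rw [min_eq_right (by nlinarith [norm_nonneg z]), hsum, jointIncrement, if_pos (hz.trans hρ1),
      inner_smul_right]
    linarith
  have hDm := measurable_jointIncrement hu hv x y (p₁ + p₂)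
  have hDb := abs_jointIncrement_le huM hvM x y (p₁ + p₂)
  rw [← hsum]
  refine le_of_forall_pos_le_add fun ε hε => ?_
  obtain ⟨δ, hδ, hδρ, hδε⟩ := exists_near_lt (S := S) hd hρ hρ1
    (show 0 < ε / (κ + 2 * N + 1) by positivity)
  have hδ1 := hδρ.trans hρ1
  have e1 := h1 p₁ (κ + N) δ (by positivity) hδ hδ1 fun z hz => hq₁ z (hz.trans hδρ)
  have e2 := h2 p₂ N δ hN hδ hδ1 fun z hz => hq₂ z (hz.trans hδρ)
  have e3 : ∫ z in {z | δ ≤ ‖z‖}, jointIncrement u v x y (p₁ + p₂) z * S.j ‖z‖ =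
      (∫ z in {z | δ ≤ ‖z‖}, increment u x p₁ z * S.j ‖z‖) +
      ∫ z in {z | δ ≤ ‖z‖}, increment v y p₂ z * S.j ‖z‖ := by
    rw [← integral_add
      (integrableOn_far hd (measurable_increment hu x p₁) hδ hδ1 (abs_increment_le huM x p₁))
      (integrableOn_far hd (measurable_increment hv y p₂) hδ hδ1 (abs_increment_le hvM y p₂))]
    congr 1; ext z
    rw [jointIncrement_eq]; ring
  have hiδ := integrableOn_far (S := S) hd hDm hδ hδ1 hDb
  have hsub : {z : Rd d | ρ ≤ ‖z‖} ⊆ {z | δ ≤ ‖z‖} := fun z hz => hδρ.trans hz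
  have e4 := setIntegral_sdiff (measurableSet_far ρ) hiδ hsub
  have hms : MeasurableSet ({z : Rd d | δ ≤ ‖z‖} \ {z | ρ ≤ ‖z‖}) :=
    (measurableSet_far δ).diff (measurableSet_far ρ)
  have e5 : -(κ * ∫ z : Rd d, min 1 (‖z‖ ^ 2) * S.j ‖z‖) ≤
      ∫ z in {z : Rd d | δ ≤ ‖z‖} \ {z | ρ ≤ ‖z‖},
        jointIncrement u v x y (p₁ + p₂) z * S.j ‖z‖ := by
    calc _ ≤ -(κ * ∫ z in {z : Rd d | δ ≤ ‖z‖} \ {z | ρ ≤ ‖z‖},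
          min 1 (‖z‖ ^ 2) * S.j ‖z‖) := by
          have := setIntegral_le_integral (s := {z : Rd d | δ ≤ ‖z‖} \ {z | ρ ≤ ‖z‖}) hmin
            (Eventually.of_forall hmin0)
          have := mul_le_mul_of_nonneg_left this hκ
          linarith
      _ ≤ _ := by
          rw [← neg_mul, ← integral_const_mul]
          refine setIntegral_mono_on (hmin.integrableOn.const_mul _)
            (hiδ.mono_set sdiff_subset) hms fun z hz => ?_
          rw [← mul_assoc, neg_mul]
          exact mul_le_mul_of_nonneg_right (hD z (not_le.1 hz.2).le) (S.j_nonneg _)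
  have e6 : (κ + 2 * N) * ∫ z in {z : Rd d | ‖z‖ < δ}, ‖z‖ ^ 2 * S.j ‖z‖ ≤ ε := by
    have h0 : 0 ≤ ∫ z in {z : Rd d | ‖z‖ < δ}, ‖z‖ ^ 2 * S.j ‖z‖ :=
      integral_nonneg fun z => mul_nonneg (by positivity) (S.j_nonneg _)
    rw [lt_div_iff₀ (by positivity)] at hδε
    nlinarith
  linarith

/-- If `u` and `v` are subsolutions and `u + v` has a local maximum at `x₀`, then the truncated
operator applied to `u + v` at `x₀` is bounded by the sum of the right-hand sides. -/
lemma TruncSub.far_integral_add_le (hd : 2 ≤ d) {u v g h : Rd d → ℝ} (hu : Continuous u)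
    (hv : UniformContinuous v) {M : ℝ} (huM : ∀ y, |u y| ≤ M) (hvM : ∀ y, |v y| ≤ M)
    {x₀ : Rd d} (h1 : ∀ᶠ x in 𝓝 x₀, TruncSub S u g x) (h2 : ∀ᶠ x in 𝓝 x₀, TruncSub S v h x)
    (hg : ContinuousAt g x₀) (hh : ContinuousAt h x₀) {ρ : ℝ} (hρ : 0 < ρ) (hρ1 : ρ ≤ 1)
    (hmax : ∀ x ∈ closedBall x₀ (2 * ρ), u x + v x ≤ u x₀ + v x₀) :
    ∫ z in {z : Rd d | ρ ≤ ‖z‖}, (u x₀ + v x₀ - u (x₀ + z) - v (x₀ + z)) * S.j ‖z‖ ≤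
      g x₀ + h x₀ := by
  have hvc := hv.continuous
  have hM0 : 0 ≤ M := (abs_nonneg _).trans (huM x₀)
  set I : ℝ := ∫ z : Rd d, min 1 (‖z‖ ^ 2) * S.j ‖z‖
  have hI : 0 ≤ I := integral_nonneg fun z => mul_nonneg (by positivity) (S.j_nonneg _)
  suffices key : ∀ κ > 0,
      ∫ z in {z : Rd d | ρ ≤ ‖z‖}, (u x₀ + v x₀ - u (x₀ + z) - v (x₀ + z)) * S.j ‖z‖ ≤
      g x₀ + h x₀ + κ * I by
    refine le_of_forall_pos_le_add fun ε hε => (key (ε / (I + 1)) (by positivity)).trans ?_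
    have : ε / (I + 1) * I ≤ ε := by
      rw [div_mul_eq_mul_div, div_le_iff₀ (by positivity)]
      nlinarith
    linarith
  intro κ hκ
  set K : Set (Rd d × Rd d) := closedBall x₀ (2 * ρ) ×ˢ closedBall x₀ (2 * ρ)
  have hKc : IsCompact K := (isCompact_closedBall _ _).prod (isCompact_closedBall _ _)
  have hx₀K : (x₀, x₀) ∈ K := ⟨mem_closedBall_self (by positivity),
    mem_closedBall_self (by positivity)⟩
  have hex : ∀ N : ℕ, ∃ q ∈ K, IsMaxOn (doubled u v x₀ κ N) K q := fun N =>
    hKc.exists_isMaxOn ⟨_, hx₀K⟩ (by unfold doubled; fun_prop)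
  choose q hqK hqmax using hex
  have hge : ∀ N : ℕ, u x₀ + v x₀ ≤ doubled u v x₀ κ N (q N) := by
    intro N
    have : doubled u v x₀ κ N (x₀, x₀) ≤ doubled u v x₀ κ N (q N) := hqmax N hx₀K
    simpa [doubled] using this
  have hd1 : Tendsto (fun N => ‖(q N).1 - (q N).2‖ ^ 2) atTop (𝓝 0) := by
    have ht : Tendsto (fun N : ℕ => 4 * M / (N : ℝ)) atTop (𝓝 0) :=
      tendsto_const_div_atTop_nhds_zero_nat _
    refine squeeze_zero' (Eventually.of_forall fun N => by positivity) ?_ ht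
    filter_upwards [eventually_gt_atTop 0] with N hN
    have hN' : (0:ℝ) < N := by exact_mod_cast hN
    rw [le_div_iff₀ hN']
    have h3 := hge N
    simp only [doubled] at h3
    have := (abs_le.1 (huM x₀)).1
    have := (abs_le.1 (hvM x₀)).1
    have := (abs_le.1 (huM (q N).1)).2
    have := (abs_le.1 (hvM (q N).2)).2
    have : 0 ≤ κ * ‖(q N).1 - x₀‖ ^ 2 := by positivity
    linarith
  have hd2 : Tendsto (fun N => dist (q N).1 (q N).2) atTop (𝓝 0) := by
    have := hd1.sqrt
    simpa [Real.sqrt_sq (norm_nonneg _), dist_eq_norm] using this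
  have hd3 : Tendsto (fun N => dist (v (q N).1) (v (q N).2)) atTop (𝓝 0) := by
    have h3 := Tendsto.comp
      (show Tendsto (fun p : Rd d × Rd d => (v p.1, v p.2)) (uniformity _) (uniformity _) from hv)
      (tendsto_uniformity_iff_dist_tendsto_zero.2 hd2)
    exact tendsto_uniformity_iff_dist_tendsto_zero.1 h3
  have hd4 : Tendsto (fun N => ‖(q N).1 - x₀‖ ^ 2) atTop (𝓝 0) := by
    have ht := hd3.div_const κ
    rw [zero_div] at ht
    refine squeeze_zero (fun N => by positivity) (fun N => ?_) ht
    rw [le_div_iff₀ hκ]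
    have h3 := hge N
    have h4 := hmax _ (hqK N).1
    have h5 := neg_abs_le (v (q N).1 - v (q N).2)
    simp only [doubled] at h3
    rw [Real.dist_eq]
    have : 0 ≤ (N : ℝ) * ‖(q N).1 - (q N).2‖ ^ 2 := by positivity
    linarith
  have hx : Tendsto (fun N => (q N).1) atTop (𝓝 x₀) := by
    rw [tendsto_iff_dist_tendsto_zero]
    have := hd4.sqrt
    simpa [Real.sqrt_sq (norm_nonneg _), dist_eq_norm] using this
  have hy : Tendsto (fun N => (q N).2) atTop (𝓝 x₀) := by
    have h5 : Tendsto (fun N => (q N).1 - (q N).2) atTop (𝓝 0) := by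
      rw [tendsto_zero_iff_norm_tendsto_zero]
      simpa [dist_eq_norm] using hd2
    simpa using hx.sub h5
  have hineq : ∀ᶠ N : ℕ in atTop, ∫ z in {z | ρ ≤ ‖z‖},
      jointIncrement u v (q N).1 (q N).2 ((2 * κ) • ((q N).1 - x₀)) z * S.j ‖z‖ ≤
      g (q N).1 + h (q N).2 + κ * I := by
    filter_upwards [hx.eventually h1, hy.eventually h2, hx.eventually (ball_mem_nhds x₀ hρ),
      hy.eventually (ball_mem_nhds x₀ hρ)] with N s1 s2 b1 b2
    refine far_integral_le_of_doubled_max hd hu hvc huM hvM hκ.le (Nat.cast_nonneg N) hρ hρ1 s1 s2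
      fun a b ha hb => hqmax N ⟨?_, ?_⟩
    · rw [mem_closedBall, dist_eq_norm]
      have : (q N).1 + a - x₀ = ((q N).1 - x₀) + a := by abel
      rw [this]
      rw [dist_eq_norm] at b1
      exact (norm_add_le _ _).trans (by linarith)
    · rw [mem_closedBall, dist_eq_norm]
      have : (q N).2 + b - x₀ = ((q N).2 - x₀) + b := by abel
      rw [this]
      rw [dist_eq_norm] at b2
      exact (norm_add_le _ _).trans (by linarith)
  have hlim : Tendsto (fun N : ℕ => ∫ z in {z | ρ ≤ ‖z‖},
      jointIncrement u v (q N).1 (q N).2 ((2 * κ) • ((q N).1 - x₀)) z * S.j ‖z‖) atTop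
      (𝓝 (∫ z in {z : Rd d | ρ ≤ ‖z‖},
        (u x₀ + v x₀ - u (x₀ + z) - v (x₀ + z)) * S.j ‖z‖)) := by
    set B : ℝ := 4 * M + 2 * κ * (2 * ρ)
    have hB : 0 ≤ B := by positivity
    have hp : ∀ N, ‖(2 * κ) • ((q N).1 - x₀)‖ ≤ 2 * κ * (2 * ρ) := fun N => by
      rw [norm_smul, Real.norm_eq_abs, abs_of_pos (by positivity)]
      have := (hqK N).1
      rw [mem_closedBall, dist_eq_norm] at this
      gcongr
    refine tendsto_integral_of_dominated_convergence (fun z => B * S.j ‖z‖) (fun N => ?_) ?_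
      (fun N => ?_) ?_
    · have := measurable_jointIncrement hu hvc (q N).1 (q N).2 ((2 * κ) • ((q N).1 - x₀))
      fun_prop
    · exact integrableOn_far hd measurable_const hρ hρ1 (K := B)
        (fun z => (abs_of_nonneg hB).le)
    · refine Eventually.of_forall fun z => ?_
      rw [Real.norm_eq_abs, abs_mul, abs_of_nonneg (S.j_nonneg _)]
      refine mul_le_mul_of_nonneg_right ?_ (S.j_nonneg _)
      exact (abs_jointIncrement_le huM hvM _ _ _ _).trans (by simp only [B]; linarith [hp N])
    · refine Eventually.of_forall fun z => Tendsto.mul_const _ ?_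
      have t1 : Tendsto (fun N => u (q N).1 + v (q N).2 - u ((q N).1 + z) - v ((q N).2 + z)) atTop
          (𝓝 (u x₀ + v x₀ - u (x₀ + z) - v (x₀ + z))) :=
        ((((hu.tendsto _).comp hx).add ((hvc.tendsto _).comp hy)).sub
          ((hu.tendsto _).comp (hx.add_const z))).sub ((hvc.tendsto _).comp (hy.add_const z))
      have t2 : Tendsto (fun N => if ‖z‖ ≤ 1 then ⟪z, (2 * κ) • ((q N).1 - x₀)⟫ else (0 : ℝ)) atTop
          (𝓝 0) := by
        split_ifs
        · have hc : Continuous fun a : Rd d => ⟪z, (2 * κ) • (a - x₀)⟫ := by fun_prop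
          have h6 := (hc.tendsto x₀).comp hx
          simp only [sub_self, smul_zero, inner_zero_right] at h6
          exact h6
        · exact tendsto_const_nhds
      simpa [jointIncrement] using t1.add t2
  refine le_of_tendsto_of_tendsto hlim ?_ hineq
  exact ((hg.tendsto.comp hx).add (hh.tendsto.comp hy)).add_const _

end Doubling

/-! ### Reflections -/

section Reflection

variable {d : ℕ} {S : PsiSetting d} {e : Rd d} {lam : ℝ}

/-- The linear part of `reflAt e lam`, as an isometry. -/
def reflLin (e : Rd d) : Rd d ≃ₗᵢ[ℝ] Rd d := (ℝ ∙ e)ᗮ.reflection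

lemma reflLin_apply (he : ‖e‖ = 1) (z : Rd d) : reflLin e z = z - (2 * ⟪z, e⟫) • e := by
  unfold reflLin
  rw [Submodule.reflection_orthogonal_apply, Submodule.reflection_singleton_apply]
  simp [he, real_inner_comm, mul_smul, two_smul]

lemma reflLin_reflLin (z : Rd d) : reflLin e (reflLin e z) = z :=
  Submodule.reflection_reflection _ z

lemma inner_reflLin_left (z p : Rd d) : ⟪reflLin e z, p⟫ = ⟪z, reflLin e p⟫ := by
  rw [← (reflLin e).inner_map_map, reflLin_reflLin]

lemma reflAt_eq (he : ‖e‖ = 1) (x : Rd d) :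
    reflAt e lam x = reflLin e x + (2 * lam) • e := by
  rw [reflLin_apply he, reflAt, sub_smul]; abel

lemma reflAt_add (he : ‖e‖ = 1) (y z : Rd d) :
    reflAt e lam (y + z) = reflAt e lam y + reflLin e z := by
  rw [reflAt_eq he, reflAt_eq he, map_add]; abel

lemma continuous_reflAt : Continuous (reflAt e lam) := by unfold reflAt; fun_prop

lemma inner_reflAt (he : ‖e‖ = 1) (x : Rd d) : ⟪reflAt e lam x, e⟫ = 2 * lam - ⟪x, e⟫ := by
  rw [reflAt, inner_sub_left, real_inner_smul_left, real_inner_self_eq_norm_sq, he]; ring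

lemma reflAt_reflAt (he : ‖e‖ = 1) (x : Rd d) : reflAt e lam (reflAt e lam x) = x := by
  rw [reflAt, inner_reflAt he, reflAt, sub_sub, ← add_smul]
  ring_nf; simp

lemma reflAt_of_inner_eq {x : Rd d} (h : ⟪x, e⟫ = lam) : reflAt e lam x = x := by
  simp [reflAt, h]

lemma dist_reflAt_reflAt (he : ‖e‖ = 1) (x y : Rd d) :
    dist (reflAt e lam x) (reflAt e lam y) = dist x y := by
  rw [reflAt_eq he, reflAt_eq he, dist_add_right, (reflLin e).dist_map]

lemma norm_reflAt_sub (he : ‖e‖ = 1) (x y : Rd d) :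
    ‖reflAt e lam x - y‖ = ‖x - reflAt e lam y‖ := by
  rw [← dist_eq_norm, ← dist_eq_norm, ← dist_reflAt_reflAt he, reflAt_reflAt he]

lemma norm_sub_reflAt_sq (he : ‖e‖ = 1) (x y : Rd d) :
    ‖y - reflAt e lam x‖ ^ 2 = ‖y - x‖ ^ 2 + 4 * (⟪y, e⟫ - lam) * (⟪x, e⟫ - lam) := by
  have h : y - reflAt e lam x = (y - x) + (2 * ⟪x, e⟫ - 2 * lam) • e := by rw [reflAt]; abel
  rw [h, norm_add_sq_real, norm_smul, he, real_inner_smul_right, inner_sub_left, mul_one,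
    Real.norm_eq_abs, sq_abs]
  ring

lemma norm_reflAt_sq (he : ‖e‖ = 1) (x : Rd d) :
    ‖reflAt e lam x‖ ^ 2 = ‖x‖ ^ 2 - 4 * lam * (⟪x, e⟫ - lam) := by
  have h := norm_sub_reflAt_sq (lam := lam) he x 0
  simp only [zero_sub, norm_neg, inner_zero_left] at h
  linarith

lemma measurePreserving_reflAt (he : ‖e‖ = 1) :
    MeasurePreserving (reflAt e lam) volume volume := by
  have h := (measurePreserving_add_right (volume : Measure (Rd d)) ((2 * lam) • e)).comp
    (reflLin e).measurePreserving
  rwa [show (fun x : Rd d => x + (2 * lam) • e) ∘ reflLin e = reflAt e lam from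
    funext fun x => (reflAt_eq he x).symm] at h

lemma measurableEmbedding_reflAt (he : ‖e‖ = 1) : MeasurableEmbedding (reflAt e lam) :=
  (MeasurableEquiv.mk ⟨reflAt e lam, reflAt e lam, reflAt_reflAt he, reflAt_reflAt he⟩
    continuous_reflAt.measurable continuous_reflAt.measurable).measurableEmbedding

lemma measurableSet_halfSpace : MeasurableSet (halfSpace e lam) :=
  measurableSet_lt (by fun_prop) (by fun_prop)

lemma preimage_reflAt_Iio (he : ‖e‖ = 1) :
    reflAt e lam ⁻¹' {y : Rd d | ⟪y, e⟫ < lam} = halfSpace e lam := by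
  ext y
  simp only [mem_preimage, mem_ofPred_eq, inner_reflAt he, halfSpace]
  constructor <;> intro h <;> linarith

lemma TruncSub.comp_reflAt (he : ‖e‖ = 1) {v g : Rd d → ℝ} {y : Rd d}
    (h : TruncSub S v g (reflAt e lam y)) :
    TruncSub S (fun x => v (reflAt e lam x)) (fun x => g (reflAt e lam x)) y := by
  intro p C δ hC hδ hδ1 hq
  have h1 := h (reflLin e p) C δ hC hδ hδ1 fun z hz => by
    have h2 := hq (reflLin e z) (by rwa [LinearIsometryEquiv.norm_map])
    simp only [] at h2
    rwa [reflAt_add he, reflLin_reflLin, inner_reflLin_left, LinearIsometryEquiv.norm_map] at h2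
  have h3 := (reflLin e).measurePreserving.setIntegral_preimage_emb
    (reflLin e).toHomeomorph.measurableEmbedding
    (fun z => increment v (reflAt e lam y) (reflLin e p) z * S.j ‖z‖) {z | δ ≤ ‖z‖}
  have h4 : (reflLin e) ⁻¹' {z | δ ≤ ‖z‖} = {z | δ ≤ ‖z‖} := by
    ext z; simp
  rw [← h3, h4] at h1
  have h5 : ∀ z, increment (fun x => v (reflAt e lam x)) y p z =
      increment v (reflAt e lam y) (reflLin e p) (reflLin e z) := fun z => by
    simp only [increment, reflAt_add he, inner_reflLin_left, reflLin_reflLin,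
      LinearIsometryEquiv.norm_map]
  simpa only [h5, LinearIsometryEquiv.norm_map] using h1

end Reflection

/-! ### The folded integral estimate at a maximum in a half-space -/

section Fold

variable {d : ℕ} {S : PsiSetting d} {e : Rd d} {lam : ℝ}

/-- The integrand obtained by folding the far integral at `x₀` along the hyperplane. -/
def folded (S : PsiSetting d) (e : Rd d) (lam : ℝ) (w : Rd d → ℝ) (x₀ y : Rd d) : ℝ :=
  (w x₀ - w y) * (S.j ‖y - x₀‖ - S.j ‖y - reflAt e lam x₀‖) +
    2 * w x₀ * S.j ‖y - reflAt e lam x₀‖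

lemma j_reflAt_le (he : ‖e‖ = 1) {x₀ y : Rd d} (hx₀ : x₀ ∈ halfSpace e lam)
    (hy : y ∈ halfSpace e lam) (hne : y ≠ x₀) :
    S.j ‖y - reflAt e lam x₀‖ ≤ S.j ‖y - x₀‖ := by
  refine S.j_le (norm_pos_iff.2 (sub_ne_zero.2 hne)) ?_
  refine le_of_sq_le_sq ?_ (norm_nonneg _)
  rw [norm_sub_reflAt_sq he]
  have h1 : 0 ≤ ⟪y, e⟫ - lam := sub_nonneg.2 (le_of_lt hy)
  have h2 : 0 ≤ ⟪x₀, e⟫ - lam := sub_nonneg.2 (le_of_lt hx₀)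
  nlinarith [mul_nonneg h1 h2]

lemma folded_nonneg (he : ‖e‖ = 1) {w : Rd d → ℝ} {x₀ y : Rd d}
    (hx₀ : x₀ ∈ halfSpace e lam) (hy : y ∈ halfSpace e lam) (hne : y ≠ x₀) (h0 : 0 ≤ w x₀)
    (hmax : w y ≤ w x₀) : 0 ≤ folded S e lam w x₀ y := by
  have h1 := j_reflAt_le (S := S) he hx₀ hy hne
  have h2 := S.j_nonneg ‖y - reflAt e lam x₀‖
  unfold folded
  nlinarith [mul_nonneg (sub_nonneg.2 hmax) (sub_nonneg.2 h1), mul_nonneg h0 h2]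

lemma integrableOn_increment_far (hd : 2 ≤ d) {w : Rd d → ℝ} (hw : Continuous w) {M : ℝ}
    (hM : ∀ y, |w y| ≤ M) (x₀ : Rd d) {ρ : ℝ} (hρ : 0 < ρ) (hρ1 : ρ ≤ 1) :
    IntegrableOn (fun y => (w x₀ - w y) * S.j ‖y - x₀‖) {y | ρ ≤ ‖y - x₀‖} := by
  have h := integrableOn_far (S := S) hd (F := fun z => w x₀ - w (x₀ + z))
    (by fun_prop : Continuous _).measurable hρ hρ1 (K := 2 * M) fun z => by
      have h1 := abs_le.1 (hM x₀)
      have h2 := abs_le.1 (hM (x₀ + z))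
      exact abs_le.2 ⟨by linarith, by linarith⟩
  rw [← (measurePreserving_add_left volume x₀).integrableOn_comp_preimage
    (measurableEmbedding_addLeft x₀)]
  convert h using 1
  · ext z; simp
  · ext z; simp

lemma setIntegral_increment_far {w : Rd d → ℝ} (x₀ : Rd d) {ρ : ℝ} :
    ∫ z in {z | ρ ≤ ‖z‖}, (w x₀ - w (x₀ + z)) * S.j ‖z‖ =
      ∫ y in {y | ρ ≤ ‖y - x₀‖}, (w x₀ - w y) * S.j ‖y - x₀‖ := by
  rw [← (measurePreserving_add_left volume x₀).setIntegral_preimage_emb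
    (measurableEmbedding_addLeft x₀) (fun y => (w x₀ - w y) * S.j ‖y - x₀‖)]
  simp

/-- At a nonnegative maximum over the half-space of an antisymmetric function, a bound for the
far integrals gives a bound for the folded integral. -/
lemma folded_integral_le (hd : 2 ≤ d) (he : ‖e‖ = 1) {w : Rd d → ℝ} (hw : Continuous w) {M : ℝ}
    (hM : ∀ y, |w y| ≤ M) (hanti : AntiSym e lam w) {x₀ : Rd d} (hx₀ : x₀ ∈ halfSpace e lam)
    (h0 : 0 ≤ w x₀) (hmax : ∀ y ∈ halfSpace e lam, w y ≤ w x₀) {c ρ₁ : ℝ} (hρ₁ : 0 < ρ₁)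
    (hfar : ∀ ρ, 0 < ρ → ρ ≤ ρ₁ →
      ∫ z in {z | ρ ≤ ‖z‖}, (w x₀ - w (x₀ + z)) * S.j ‖z‖ ≤ c)
    {E : Set (Rd d)} (hEH : E ⊆ halfSpace e lam) {ρ₀ : ℝ} (hρ₀ : 0 < ρ₀)
    (hEρ : ∀ y ∈ E, ρ₀ ≤ ‖y - x₀‖) :
    IntegrableOn (folded S e lam w x₀) E ∧ ∫ y in E, folded S e lam w x₀ y ≤ c := by
  set H := halfSpace e lam
  set H' : Set (Rd d) := {y | ⟪y, e⟫ < lam}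
  set G : Rd d → ℝ := fun y => (w x₀ - w y) * S.j ‖y - x₀‖
  set K : Rd d → ℝ := fun y => (w x₀ + w y) * S.j ‖y - reflAt e lam x₀‖
  have hHm : MeasurableSet H := measurableSet_halfSpace
  have hH'm : MeasurableSet H' := measurableSet_lt (by fun_prop) (by fun_prop)
  have hfold : ∀ y, folded S e lam w x₀ y = G y + K y := fun y => by
    simp only [folded, G, K]; ring
  have hKG : (fun y => G (reflAt e lam y)) = K := by
    ext y
    simp only [G, K, norm_reflAt_sub he]
    rw [hanti y]; ring
  set D : ℝ → Set (Rd d) := fun ρ => {y | ρ ≤ ‖y - x₀‖}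
  have hDm : ∀ ρ, MeasurableSet (D ρ) := fun ρ => measurableSet_le (by fun_prop) (by fun_prop)
  set ρ₂ : ℝ := min (min ρ₀ ρ₁) (min 1 (⟪x₀, e⟫ - lam))
  have hρ₂ : 0 < ρ₂ := lt_min (lt_min hρ₀ hρ₁) (lt_min one_pos (sub_pos.2 hx₀))
  have hρ₂0 : ρ₂ ≤ ρ₀ := (min_le_left _ _).trans (min_le_left _ _)
  have hρ₂1 : ρ₂ ≤ ρ₁ := (min_le_left _ _).trans (min_le_right _ _)
  have hρ₂2 : ρ₂ ≤ 1 := (min_le_right _ _).trans (min_le_left _ _)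
  have hρ₂3 : ρ₂ ≤ ⟪x₀, e⟫ - lam := (min_le_right _ _).trans (min_le_right _ _)
  have hGD : ∀ ρ, 0 < ρ → ρ ≤ ρ₂ → IntegrableOn G (D ρ) := fun ρ h1 h2 =>
    integrableOn_increment_far hd hw hM x₀ h1 (h2.trans hρ₂2)
  have hHD : ∀ ρ ≤ ρ₂, Hᶜ ⊆ D ρ := fun ρ h2 y hy => by
    have h3 : ⟪y, e⟫ ≤ lam := not_lt.1 hy
    have h4 : |⟪y - x₀, e⟫| ≤ ‖y - x₀‖ * ‖e‖ := abs_real_inner_le_norm _ _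
    rw [he, mul_one, inner_sub_left] at h4
    have h5 := (abs_le.1 h4).1
    show ρ ≤ ‖y - x₀‖
    linarith
  have hH'H : H' ⊆ Hᶜ := fun y hy h => lt_asymm (show ⟪y, e⟫ < lam from hy) h
  have hGH : IntegrableOn G Hᶜ := (hGD ρ₂ hρ₂ le_rfl).mono_set (hHD ρ₂ le_rfl)
  have hKH : IntegrableOn K H := by
    have := ((measurePreserving_reflAt he).integrableOn_comp_preimage
      (measurableEmbedding_reflAt (lam := lam) he)).2 (hGH.mono_set hH'H)
    rw [preimage_reflAt_Iio he] at this
    rwa [← hKG]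
  have hKint : ∫ y in H, K y ≤ ∫ y in Hᶜ, G y := by
    have h1 := (measurePreserving_reflAt he).setIntegral_preimage_emb
      (measurableEmbedding_reflAt (lam := lam) he) G H'
    rw [preimage_reflAt_Iio he] at h1
    rw [← hKG, h1, ← integral_inter_add_sdiff hH'm hGH, inter_eq_self_of_subset_right hH'H]
    have h2 : 0 ≤ ∫ y in Hᶜ \ H', G y := by
      refine setIntegral_nonneg (hHm.compl.diff hH'm) fun y hy => ?_
      have h3 : ⟪y, e⟫ = lam := le_antisymm (not_lt.1 hy.1) (not_lt.1 hy.2)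
      have h4 := hanti y
      rw [reflAt_of_inner_eq h3] at h4
      have h5 : w y = 0 := by linarith
      simp only [G, h5, sub_zero]
      exact mul_nonneg h0 (S.j_nonneg _)
    linarith
  have hint : ∀ ρ, 0 < ρ → ρ ≤ ρ₂ → IntegrableOn (folded S e lam w x₀) (H ∩ D ρ) := by
    intro ρ h1 h2
    rw [show folded S e lam w x₀ = fun y => G y + K y from funext hfold]
    exact ((hGD ρ h1 h2).mono_set inter_subset_right).add (hKH.mono_set inter_subset_left)
  have hstep : ∀ ρ, 0 < ρ → ρ ≤ ρ₂ →
      ∫ y in H ∩ D ρ, folded S e lam w x₀ y ≤ c - ∫ y in H \ D ρ, K y := by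
    intro ρ h1 h2
    have h3 := hfar ρ h1 (h2.trans hρ₂1)
    rw [setIntegral_increment_far] at h3
    have h4 := integral_inter_add_sdiff hHm (hGD ρ h1 h2)
    have h5 := integral_inter_add_sdiff (hDm ρ) hKH
    have h6 : D ρ \ H = Hᶜ := by
      rw [sdiff_eq, inter_eq_self_of_subset_right (hHD ρ h2)]
    rw [h6, inter_comm] at h4
    simp only [hfold]
    rw [integral_add ((hGD ρ h1 h2).mono_set inter_subset_right)
      (hKH.mono_set inter_subset_left)]
    have h7 : ∫ y in D ρ, G y ≤ c := h3
    linarith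
  have hED : ∀ ρ ≤ ρ₂, E ⊆ H ∩ D ρ := fun ρ h2 y hy =>
    ⟨hEH hy, (h2.trans hρ₂0).trans (hEρ y hy)⟩
  refine ⟨(hint ρ₂ hρ₂ le_rfl).mono_set (hED ρ₂ le_rfl), ?_⟩
  set s : ℕ → ℝ := fun k => ρ₂ / (k + 1)
  have hs0 : ∀ k, 0 < s k := fun k => by positivity
  have hsle : ∀ k, s k ≤ ρ₂ := fun k => div_le_self hρ₂.le (by simp)
  have hst : Tendsto s atTop (𝓝 0) := by
    simpa [div_eq_mul_inv, s] using tendsto_one_div_add_atTop_nhds_zero_nat.const_mul ρ₂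
  have hlim : Tendsto (fun k => ∫ y in H \ D (s k), K y) atTop (𝓝 0) := by
    have h := tendsto_setIntegral_of_antitone (μ := volume) (f := K) (s := fun k => H \ D (s k))
      (fun k => hHm.diff (hDm _))
      (fun k l hkl y hy => ⟨hy.1, fun h => hy.2 (le_trans
        (show ρ₂ / ((l : ℝ) + 1) ≤ ρ₂ / ((k : ℝ) + 1) by gcongr) h)⟩)
      ⟨0, hKH.mono_set sdiff_subset⟩
    have h1 : volume (⋂ k, H \ D (s k)) = 0 := by
      have : Nonempty (Fin d) := ⟨⟨0, by omega⟩⟩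
      refine measure_mono_null (fun y hy => ?_) (measure_singleton x₀)
      rw [mem_iInter] at hy
      have : ‖y - x₀‖ ≤ 0 := ge_of_tendsto' hst fun k => (not_le.1 (hy k).2).le
      exact sub_eq_zero.1 (norm_le_zero_iff.1 this)
    rwa [setIntegral_measure_zero _ h1] at h
  have hlim2 := hlim.const_sub c
  rw [sub_zero] at hlim2
  refine ge_of_tendsto' hlim2 fun k => le_trans ?_ (hstep _ (hs0 k) (hsle k))
  refine setIntegral_mono_set (hint _ (hs0 k) (hsle k)) ?_
    (LE.le.eventuallyLE (hED _ (hsle k)))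
  refine (ae_restrict_iff' (hHm.inter (hDm _))).2 (Eventually.of_forall fun y hy => ?_)
  refine folded_nonneg he hx₀ hy.1 (fun h => ?_) h0 (hmax y hy.1)
  have h3 : s k ≤ ‖y - x₀‖ := hy.2
  rw [h, sub_self, norm_zero] at h3
  exact absurd h3 (not_le.2 (hs0 k))

end Fold

/-! ### Solutions in an annulus -/

section Annulus

variable {d : ℕ} {S : PsiSetting d} {r R A : ℝ} {L : ℝ≥0} {f : ℝ → ℝ} {u : Rd d → ℝ}

/-- The data of the Dirichlet problem in the annulus, with the viscosity inequalities replaced by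
the truncated ones. -/
structure AnnulusSol (S : PsiSetting d) (r R A : ℝ) (L : ℝ≥0) (f : ℝ → ℝ) (u : Rd d → ℝ) :
    Prop where
  r_pos : 0 < r
  r_lt : r < R
  A_pos : 0 < A
  lip : LipschitzOnWith L f (Icc 0 A)
  cont : Continuous u
  sub : ∀ x ∈ ball (0 : Rd d) R \ closedBall 0 r, TruncSub S u (fun x => f (u x)) x
  sup : ∀ x ∈ ball (0 : Rd d) R \ closedBall 0 r,
    TruncSub S (fun x => -u x) (fun x => -f (u x)) x
  ext : ∀ x, R ≤ ‖x‖ → u x = 0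
  inner : ∀ x, ‖x‖ ≤ r → u x = A
  bound : ∀ x, 0 ≤ u x ∧ u x ≤ A

/-- The difference between `u` and its reflection. -/
def reflDiff (u : Rd d → ℝ) (e : Rd d) (lam : ℝ) (x : Rd d) : ℝ := u x - u (reflAt e lam x)

/-- `x` is an interior maximum point of `reflDiff u e lam` over the half-space, with nonnegative
value. -/
structure IsMaxPt (u : Rd d → ℝ) (r R : ℝ) (e : Rd d) (lam : ℝ) (x : Rd d) : Prop where
  mem : x ∈ halfSpace e lam
  lt_R : ‖x‖ < R
  r_lt : r < ‖reflAt e lam x‖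
  nonneg : 0 ≤ reflDiff u e lam x
  le : ∀ y ∈ halfSpace e lam, reflDiff u e lam y ≤ reflDiff u e lam x

lemma continuous_reflDiff_uncurry (hu : Continuous u) (e : Rd d) :
    Continuous fun p : ℝ × Rd d => reflDiff u e p.1 p.2 := by
  unfold reflDiff reflAt; fun_prop

lemma continuous_reflDiff (hu : Continuous u) (e : Rd d) (lam : ℝ) :
    Continuous (reflDiff u e lam) := by
  unfold reflDiff reflAt; fun_prop

variable {e : Rd d} {lam : ℝ}

lemma antiSym_reflDiff (he : ‖e‖ = 1) : AntiSym e lam (reflDiff u e lam) := fun x => by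
  simp only [reflDiff, reflAt_reflAt he]; ring

namespace AnnulusSol

variable (h : AnnulusSol S r R A L f u)
include h

lemma abs_le (x : Rd d) : |u x| ≤ A := by
  rw [abs_of_nonneg (h.bound x).1]; exact (h.bound x).2

lemma abs_reflDiff_le (x : Rd d) : |reflDiff u e lam x| ≤ A := by
  have h1 := h.bound x
  have h2 := h.bound (reflAt e lam x)
  exact _root_.abs_le.2 ⟨by unfold reflDiff; linarith, by unfold reflDiff; linarith⟩

lemma uniformContinuous : UniformContinuous u := by
  refine HasCompactSupport.uniformContinuous_of_continuous ?_ h.cont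
  refine HasCompactSupport.intro (isCompact_closedBall (0 : Rd d) R) fun x hx => h.ext x ?_
  rw [mem_closedBall_zero_iff] at hx
  linarith

lemma folded_integral_le (hd : 2 ≤ d) (he : ‖e‖ = 1) (hlam : 0 ≤ lam) {x₀ : Rd d}
    (hx : IsMaxPt u r R e lam x₀) {E : Set (Rd d)} (hEH : E ⊆ halfSpace e lam) {ρ₀ : ℝ}
    (hρ₀ : 0 < ρ₀) (hEρ : ∀ y ∈ E, ρ₀ ≤ ‖y - x₀‖) :
    IntegrableOn (folded S e lam (reflDiff u e lam) x₀) E ∧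
      ∫ y in E, folded S e lam (reflDiff u e lam) x₀ y ≤ L * reflDiff u e lam x₀ := by
  have hdist : 0 < ⟪x₀, e⟫ - lam := sub_pos.2 hx.mem
  set ρ₁ : ℝ := min 1 ((⟪x₀, e⟫ - lam) / 4)
  have hρ₁ : 0 < ρ₁ := lt_min one_pos (by positivity)
  have hρ₁1 : ρ₁ ≤ 1 := min_le_left _ _
  have hρ₁2 : ρ₁ ≤ (⟪x₀, e⟫ - lam) / 4 := min_le_right _ _
  refine _root_.folded_integral_le hd he (continuous_reflDiff h.cont e lam) h.abs_reflDiff_le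
    (antiSym_reflDiff he) hx.mem hx.nonneg hx.le hρ₁ (fun ρ hρ hρ1 => ?_) hEH hρ₀ hEρ
  have hsq := norm_reflAt_sq (lam := lam) he x₀
  have hle : ‖reflAt e lam x₀‖ ≤ ‖x₀‖ := by
    refine le_of_sq_le_sq ?_ (norm_nonneg _)
    nlinarith [mul_nonneg hlam hdist.le]
  have hopen : IsOpen (ball (0 : Rd d) R \ closedBall 0 r) := isOpen_ball.sdiff isClosed_closedBall
  have hm1 : x₀ ∈ ball (0 : Rd d) R \ closedBall 0 r := by
    simp only [Set.mem_sdiff, mem_ball_zero_iff, mem_closedBall_zero_iff, not_le]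
    exact ⟨hx.lt_R, hx.r_lt.trans_le hle⟩
  have hm2 : reflAt e lam x₀ ∈ ball (0 : Rd d) R \ closedBall 0 r := by
    simp only [Set.mem_sdiff, mem_ball_zero_iff, mem_closedBall_zero_iff, not_le]
    exact ⟨hle.trans_lt hx.lt_R, hx.r_lt⟩
  have hcR : Continuous (reflAt e lam) := continuous_reflAt
  have hfu : Continuous fun x => f (u x) := h.lip.continuousOn.comp_continuous h.cont h.bound
  have hv : UniformContinuous fun x => -u (reflAt e lam x) := by
    have h1 : UniformContinuous (reflAt e lam) :=
      (Isometry.of_dist_eq (dist_reflAt_reflAt he)).uniformContinuous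
    exact (h.uniformContinuous.comp h1).neg
  have hkey := TruncSub.far_integral_add_le (S := S) (h := fun x => -f (u (reflAt e lam x)))
    (v := fun x => -u (reflAt e lam x)) hd h.cont hv h.abs_le
    (fun y => by rw [abs_neg]; exact h.abs_le _)
    (x₀ := x₀) (Filter.eventually_of_mem (hopen.mem_nhds hm1) h.sub)
    (Filter.eventually_of_mem ((hopen.preimage hcR).mem_nhds hm2) fun y hy =>
      TruncSub.comp_reflAt he (h.sup _ hy))
    hfu.continuousAt (hfu.comp hcR).neg.continuousAt hρ (hρ1.trans hρ₁1) fun y hy => ?_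
  · have h1 := h.lip.dist_le_mul _ (h.bound x₀) _ (h.bound (reflAt e lam x₀))
    rw [Real.dist_eq, Real.dist_eq, show u x₀ - u (reflAt e lam x₀) = reflDiff u e lam x₀ from rfl,
      abs_of_nonneg hx.nonneg] at h1
    have h2 := le_abs_self (f (u x₀) - f (u (reflAt e lam x₀)))
    have h3 : ∀ z, reflDiff u e lam x₀ - reflDiff u e lam (x₀ + z) =
        u x₀ + -u (reflAt e lam x₀) - u (x₀ + z) - -u (reflAt e lam (x₀ + z)) := fun z => by
      unfold reflDiff; ring
    simp only [h3]
    linarith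
  · have h4 : |⟪y - x₀, e⟫| ≤ ‖y - x₀‖ * ‖e‖ := abs_real_inner_le_norm _ _
    rw [he, mul_one, inner_sub_left] at h4
    have h5 := (_root_.abs_le.1 h4).1
    rw [mem_closedBall, dist_eq_norm] at hy
    have h6 := hx.le y (show lam < ⟪y, e⟫ by linarith)
    unfold reflDiff at h6
    linarith

/-- If almost-maximum points converge inside the limiting half-space and the maxima tend to a
nonpositive limit profile, then the limit profile vanishes. -/
lemma reflDiff_eq_zero_of_tendsto (hd : 2 ≤ d) (he : ‖e‖ = 1) {l : ℕ → ℝ} {x : ℕ → Rd d} {a : Rd d}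
    (hl : ∀ n, 0 ≤ l n) (hx : ∀ n, IsMaxPt u r R e (l n) (x n)) (hlt : Tendsto l atTop (𝓝 lam))
    (hxt : Tendsto x atTop (𝓝 a)) (ha : a ∈ halfSpace e lam)
    (hm : Tendsto (fun n => reflDiff u e (l n) (x n)) atTop (𝓝 0))
    (hneg : ∀ y ∈ halfSpace e lam, reflDiff u e lam y ≤ 0) {y₀ : Rd d}
    (hy₀ : y₀ ∈ halfSpace e lam) : reflDiff u e lam y₀ = 0 := by
  by_contra hne
  have hlt0 : reflDiff u e lam y₀ < 0 := lt_of_le_of_ne (hneg _ hy₀) hne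
  have hcont := continuous_reflDiff_uncurry h.cont e
  have hya : 0 < ‖y₀ - a‖ := by
    refine norm_pos_iff.2 (sub_ne_zero.2 fun hya => hne ?_)
    rw [hya]
    exact tendsto_nhds_unique ((hcont.tendsto (lam, a)).comp (hlt.prodMk_nhds hxt)) hm
  have hdist : ‖y₀ - a‖ < ‖y₀ - reflAt e lam a‖ := by
    refine lt_of_pow_lt_pow_left₀ 2 (norm_nonneg _) ?_
    rw [norm_sub_reflAt_sq he]
    have := mul_pos (sub_pos.2 (show lam < ⟪y₀, e⟫ from hy₀))
      (sub_pos.2 (show lam < ⟪a, e⟫ from ha))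
    linarith
  obtain ⟨p, hp1, hp2⟩ := exists_between hdist
  obtain ⟨q, hq1, hq2⟩ := exists_between hp2
  have t1 : Tendsto (fun k : ℕ × Rd d => l k.1) (atTop ×ˢ 𝓝 y₀) (𝓝 lam) := hlt.comp tendsto_fst
  have t2 : Tendsto (fun k : ℕ × Rd d => x k.1) (atTop ×ˢ 𝓝 y₀) (𝓝 a) := hxt.comp tendsto_fst
  have t3 : Tendsto (fun k : ℕ × Rd d => k.2) (atTop ×ˢ 𝓝 y₀) (𝓝 y₀) := tendsto_snd
  have t4 : Tendsto (fun k : ℕ × Rd d => ‖k.2 - x k.1‖) (atTop ×ˢ 𝓝 y₀) (𝓝 ‖y₀ - a‖) :=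
    (t3.sub t2).norm
  have t5 : Tendsto (fun k : ℕ × Rd d => ‖k.2 - reflAt e (l k.1) (x k.1)‖) (atTop ×ˢ 𝓝 y₀)
      (𝓝 ‖y₀ - reflAt e lam a‖) := by
    have hc : Continuous fun k : ℝ × Rd d => reflAt e k.1 k.2 := by unfold reflAt; fun_prop
    exact (t3.sub ((hc.tendsto (lam, a)).comp (t1.prodMk_nhds t2))).norm
  have t6 : Tendsto (fun k : ℕ × Rd d => ⟪k.2, e⟫ - l k.1) (atTop ×ˢ 𝓝 y₀)
      (𝓝 (⟪y₀, e⟫ - lam)) := (t3.inner tendsto_const_nhds).sub t1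
  have t7 : Tendsto (fun k : ℕ × Rd d => reflDiff u e (l k.1) k.2) (atTop ×ˢ 𝓝 y₀)
      (𝓝 (reflDiff u e lam y₀)) := (hcont.tendsto (lam, y₀)).comp (t1.prodMk_nhds t3)
  set c : ℝ := -reflDiff u e lam y₀ / 2
  have hc0 : 0 < c := by simp only [c]; linarith
  have hev := (((t4.eventually_lt_const hp1).and (t5.eventually_const_lt hq2)).and
    ((t6.eventually_const_lt (sub_pos.2 hy₀)).and
    ((t7.eventually_lt_const (show reflDiff u e lam y₀ < -c by simp only [c]; linarith)).and
      (t4.eventually_const_lt (half_lt_self hya)))))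
  obtain ⟨P, hP, Q, hQ, hPQ⟩ := eventually_prod_iff.1 hev
  obtain ⟨η, hη, hηQ⟩ := Metric.eventually_nhds_iff_ball.1 hQ
  have hjpos : 0 < S.j p - S.j q := sub_pos.2 (S.j_lt (hya.trans hp1) hq1)
  have hvol : 0 < (volume : Measure (Rd d)).real (ball y₀ η) := by
    rw [Measure.real]
    exact ENNReal.toReal_pos (measure_ball_pos _ _ hη).ne' measure_ball_lt_top.ne
  have hbound : ∀ᶠ n in atTop,
      (volume : Measure (Rd d)).real (ball y₀ η) * (c * (S.j p - S.j q)) ≤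
        L * reflDiff u e (l n) (x n) := by
    filter_upwards [hP] with n hn
    have hb := fun y (hy : y ∈ ball y₀ η) => hPQ hn (hηQ y hy)
    have hEH : ball y₀ η ⊆ halfSpace e (l n) := fun y hy => sub_pos.1 (hb y hy).2.1
    obtain ⟨hi, hle⟩ := h.folded_integral_le hd he (hl n) (hx n) hEH (half_pos hya)
      fun y hy => (hb y hy).2.2.2.le
    refine le_trans ?_ hle
    rw [← smul_eq_mul, ← setIntegral_const]
    refine setIntegral_mono_on (integrableOn_const measure_ball_lt_top.ne) hi measurableSet_ball
      fun y hy => ?_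
    obtain ⟨⟨b1, b2⟩, b3, b4, b5⟩ := hb y hy
    have j1 : S.j p ≤ S.j ‖y - x n‖ := S.j_le ((half_pos hya).trans b5) b1.le
    have j2 : S.j ‖y - reflAt e (l n) (x n)‖ ≤ S.j q :=
      S.j_le ((hya.trans hp1).trans hq1) b2.le
    have hn0 := (hx n).nonneg
    unfold folded
    have s1 : c * (S.j p - S.j q) ≤ (reflDiff u e (l n) (x n) - reflDiff u e (l n) y) *
        (S.j ‖y - x n‖ - S.j ‖y - reflAt e (l n) (x n)‖) := by
      simp only at b4
      exact mul_le_mul (by linarith) (by linarith) hjpos.le (by linarith)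
    have s2 := mul_nonneg hn0 (S.j_nonneg ‖y - reflAt e (l n) (x n)‖)
    linarith
  have hlim := hm.const_mul (L : ℝ)
  rw [mul_zero] at hlim
  have := ge_of_tendsto hlim hbound
  have : 0 < (volume : Measure (Rd d)).real (ball y₀ η) * (c * (S.j p - S.j q)) := by positivity
  linarith

/-- Strong maximum principle for `reflDiff`. -/
lemma reflDiff_eq_zero (hd : 2 ≤ d) (he : ‖e‖ = 1) (hlam : 0 ≤ lam)
    (hneg : ∀ y ∈ halfSpace e lam, reflDiff u e lam y ≤ 0) {x₀ : Rd d}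
    (hx₀ : x₀ ∈ halfSpace e lam) (hR : ‖x₀‖ < R) (hr : r < ‖reflAt e lam x₀‖)
    (h0 : reflDiff u e lam x₀ = 0) {y : Rd d} (hy : y ∈ halfSpace e lam) :
    reflDiff u e lam y = 0 := by
  have hx : IsMaxPt u r R e lam x₀ := ⟨hx₀, hR, hr, h0.ge, fun y hy => h0 ▸ hneg y hy⟩
  exact h.reflDiff_eq_zero_of_tendsto hd he (l := fun _ => lam) (x := fun _ => x₀)
    (fun _ => hlam) (fun _ => hx) tendsto_const_nhds tendsto_const_nhds hx₀
    (by rw [h0]; exact tendsto_const_nhds) hneg hy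

/-- Positive maxima cannot approach the hyperplane. -/
lemma not_tendsto_hyperplane (hd : 2 ≤ d) (he : ‖e‖ = 1) {l : ℕ → ℝ} {x : ℕ → Rd d}
    (hl : ∀ n, 0 ≤ l n) (hx : ∀ n, IsMaxPt u r R e (l n) (x n))
    (hpos : ∀ n, 0 < reflDiff u e (l n) (x n)) :
    ¬ Tendsto (fun n => ⟪x n, e⟫ - l n) atTop (𝓝 0) := by
  intro ht
  have hstep : ∀ n, ∫⁻ z in {z : Rd d | 3 * (⟪x n, e⟫ - l n) < ⟪z, e⟫}, ENNReal.ofReal (S.j ‖z‖) ≤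
      ENNReal.ofReal (L / 2) := by
    intro n
    set δ : ℝ := ⟪x n, e⟫ - l n
    set m : ℝ := reflDiff u e (l n) (x n)
    have hm : 0 < m := hpos n
    have hδ : 0 < δ := sub_pos.2 (hx n).mem
    set b : Rd d := reflAt e (l n) (x n)
    set E : Set (Rd d) := {y | l n + 2 * δ < ⟪y, e⟫}
    have hEH : E ⊆ halfSpace e (l n) := fun y hy => by
      have hy' : l n + 2 * δ < ⟪y, e⟫ := hy
      show l n < ⟪y, e⟫
      linarith
    have hEρ : ∀ y ∈ E, δ ≤ ‖y - x n‖ := fun y hy => by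
      have hy' : l n + 2 * δ < ⟪y, e⟫ := hy
      have h4 : |⟪y - x n, e⟫| ≤ ‖y - x n‖ * ‖e‖ := abs_real_inner_le_norm _ _
      rw [he, mul_one, inner_sub_left] at h4
      have h5 := (_root_.abs_le.1 h4).2
      simp only [δ] at hy' ⊢
      linarith
    have hEm : MeasurableSet E := measurableSet_lt (by fun_prop) (by fun_prop)
    obtain ⟨hi, hle⟩ := h.folded_integral_le hd he (hl n) (hx n) hEH hδ hEρ
    have hge : ∀ y ∈ E, 2 * m * S.j ‖y - b‖ ≤ folded S e (l n) (reflDiff u e (l n)) (x n) y := by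
      intro y hy
      have hne : y ≠ x n := fun hyx => by
        have := hEρ y hy
        rw [hyx, sub_self, norm_zero] at this
        linarith
      have h1 := mul_nonneg (sub_nonneg.2 ((hx n).le y (hEH hy)))
        (sub_nonneg.2 (j_reflAt_le (S := S) he (hx n).mem (hEH hy) hne))
      unfold folded
      linarith
    have hpre : (fun z => b + z) ⁻¹' E = {z : Rd d | 3 * δ < ⟪z, e⟫} := by
      ext z
      simp only [E, mem_preimage, mem_ofPred_eq, inner_add_left, b, inner_reflAt he, δ]
      constructor <;> intro h <;> linarith
    have htr := (measurePreserving_add_left volume b).setLIntegral_comp_preimage_emb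
      (measurableEmbedding_addLeft b) (fun y => ENNReal.ofReal (S.j ‖y - b‖)) E
    rw [hpre] at htr
    simp only [add_sub_cancel_left] at htr
    rw [htr]
    calc ∫⁻ y in E, ENNReal.ofReal (S.j ‖y - b‖)
        ≤ ∫⁻ y in E, ENNReal.ofReal
            ((2 * m)⁻¹ * folded S e (l n) (reflDiff u e (l n)) (x n) y) := by
          refine setLIntegral_mono' hEm fun y hy => ENNReal.ofReal_le_ofReal ?_
          rw [inv_mul_eq_div, le_div_iff₀ (by positivity)]
          linarith [hge y hy]
      _ = ENNReal.ofReal (∫ y in E,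
            (2 * m)⁻¹ * folded S e (l n) (reflDiff u e (l n)) (x n) y) := by
          rw [ofReal_integral_eq_lintegral_ofReal (hi.const_mul _)]
          refine (ae_restrict_iff' hEm).2 (Eventually.of_forall fun y hy => ?_)
          have h1 := hge y hy
          have h2 : 0 ≤ 2 * m * S.j ‖y - b‖ := mul_nonneg (by positivity) (S.j_nonneg _)
          exact mul_nonneg (by positivity) (h2.trans h1)
      _ ≤ ENNReal.ofReal (L / 2) := by
          refine ENNReal.ofReal_le_ofReal ?_
          rw [integral_const_mul, inv_mul_eq_div, div_le_iff₀ (by positivity)]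
          linarith
  have hsets : {z : Rd d | ⟪z, -e⟫ < 0} = ⋃ k : ℕ, {z : Rd d | 1 / ((k : ℝ) + 1) < ⟪z, e⟫} := by
    ext z
    simp only [mem_ofPred_eq, mem_iUnion, inner_neg_right, neg_lt_zero]
    refine ⟨fun hz => exists_nat_one_div_lt hz, fun ⟨k, hk⟩ => lt_trans (by positivity) hk⟩
  have htop := S.lintegral_j_halfSpace hd (-e) (by rw [norm_neg, he])
  rw [hsets, setLIntegral_iUnion_of_directed] at htop
  · have : (⨆ k : ℕ, ∫⁻ z in {z : Rd d | 1 / ((k : ℝ) + 1) < ⟪z, e⟫}, ENNReal.ofReal (S.j ‖z‖)) ≤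
        ENNReal.ofReal (L / 2) := by
      refine iSup_le fun k => ?_
      have h3 := ht.const_mul 3
      rw [mul_zero] at h3
      obtain ⟨n, hn⟩ := (h3.eventually_lt_const
        (show (0 : ℝ) < 1 / ((k : ℝ) + 1) by positivity)).exists
      exact (lintegral_mono_set fun z hz => lt_trans hn hz).trans (hstep n)
    rw [htop] at this
    exact absurd this (not_le.2 ENNReal.ofReal_lt_top)
  · refine Monotone.directed_le fun k k' hk z hz => lt_of_le_of_lt ?_
      (show 1 / ((k : ℝ) + 1) < ⟪z, e⟫ from hz)
    exact one_div_le_one_div_of_le (by positivity) (by gcongr)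

end AnnulusSol

end Annulus

/-! ### Moving planes -/

section MovingPlanes

variable {d : ℕ} {S : PsiSetting d} {r R A : ℝ} {L : ℝ≥0} {f : ℝ → ℝ} {u : Rd d → ℝ}
  {e : Rd d} {lam : ℝ}

lemma inner_le_norm_of_unit (he : ‖e‖ = 1) (x : Rd d) : ⟪x, e⟫ ≤ ‖x‖ := by
  simpa [he] using real_inner_le_norm x e

lemma reflAt_smul (he : ‖e‖ = 1) (s : ℝ) : reflAt e lam (s • e) = (2 * lam - s) • e := by
  rw [reflAt, real_inner_smul_left, real_inner_self_eq_norm_sq, he, ← sub_smul]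
  ring_nf

namespace AnnulusSol

variable (h : AnnulusSol S r R A L f u)
include h

lemma not_reflDiff_eq_zero (hd : 2 ≤ d) (he : ‖e‖ = 1) (hlam : 0 < lam) :
    ¬ ∀ y ∈ halfSpace e lam, reflDiff u e lam y = 0 := by
  intro hz
  have hr := h.r_pos
  have hA := h.A_pos
  have hee : ⟪e, e⟫ = (1 : ℝ) := by rw [real_inner_self_eq_norm_sq, he, one_pow]
  have hu0 : ∀ y : Rd d, ⟪y, e⟫ ≤ 2 * lam - R → u y = 0 := by
    intro y hy
    have h2 : R ≤ ‖reflAt e lam y‖ := by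
      have := inner_le_norm_of_unit he (reflAt e lam y)
      rw [inner_reflAt he] at this
      linarith
    rcases lt_trichotomy ⟪y, e⟫ lam with h3 | h3 | h3
    · have h4 := hz (reflAt e lam y) (show lam < ⟪_, e⟫ by rw [inner_reflAt he]; linarith)
      rw [reflDiff, reflAt_reflAt he, h.ext _ h2] at h4
      linarith
    · rw [← reflAt_of_inner_eq h3]
      exact h.ext _ h2
    · have h5 := hz y h3
      rw [reflDiff, h.ext _ h2] at h5
      linarith
  have hlt : r < R - 2 * lam := by
    by_contra hcon
    have h1 := hu0 ((-r) • e) (by rw [real_inner_smul_left, hee]; linarith)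
    rw [h.inner _ (by rw [norm_smul, he, Real.norm_eq_abs, abs_neg, abs_of_pos hr, mul_one])] at h1
    linarith
  have he' : ‖-e‖ = 1 := by rw [norm_neg, he]
  have hH' : ∀ y ∈ halfSpace (-e) (R - lam), u y = 0 := fun y hy => by
    have h1 : R - lam < ⟪y, -e⟫ := hy
    rw [inner_neg_right] at h1
    exact hu0 y (by linarith)
  have hmem : ∀ s : ℝ, R - lam < s → s • (-e) ∈ halfSpace (-e) (R - lam) := fun s hs => by
    show R - lam < ⟪s • (-e), -e⟫
    rwa [real_inner_smul_left, inner_neg_neg, hee, mul_one]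
  have hnorm : ∀ s : ℝ, 0 ≤ s → ‖s • (-e)‖ = s := fun s hs => by
    rw [norm_smul, he', mul_one, Real.norm_of_nonneg hs]
  have hx₀ := hmem (R - lam / 2) (by linarith)
  have hz0 : reflDiff u (-e) (R - lam) ((R - lam / 2) • (-e)) = 0 := by
    rw [reflDiff, hH' _ hx₀, reflAt_smul he', hu0, sub_zero]
    rw [smul_neg, inner_neg_left, real_inner_smul_left, hee]
    linarith
  have hsmp := h.reflDiff_eq_zero hd he' (by linarith)
    (fun y hy => by
      rw [reflDiff, hH' y hy, zero_sub]
      exact neg_nonpos.2 (h.bound _).1)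
    hx₀ (by rw [hnorm _ (by linarith)]; linarith)
    (by rw [reflAt_smul he', hnorm _ (by linarith)]; linarith) hz0
    (hmem (2 * (R - lam)) (by linarith))
  rw [reflDiff, hH' _ (hmem _ (by linarith)), reflAt_smul he', sub_self, zero_smul,
    h.inner 0 (by rw [norm_zero]; exact hr.le)] at hsmp
  linarith

lemma exists_isMaxPt {z : Rd d} (hz : z ∈ halfSpace e lam)
    (hpos : 0 < reflDiff u e lam z) : ∃ x, IsMaxPt u r R e lam x ∧ 0 < reflDiff u e lam x := by
  have hout : ∀ y, 0 < reflDiff u e lam y → ‖y‖ < R := fun y hy => by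
    by_contra hcon
    rw [reflDiff, h.ext y (not_lt.1 hcon)] at hy
    linarith [(h.bound (reflAt e lam y)).1]
  set K : Set (Rd d) := closedBall 0 R ∩ {y | lam ≤ ⟪y, e⟫}
  have hK : IsCompact K :=
    (isCompact_closedBall 0 R).inter_right (isClosed_le continuous_const (by fun_prop))
  have hzK : z ∈ K := ⟨mem_closedBall_zero_iff.2 (hout z hpos).le, le_of_lt (show lam < ⟪z, e⟫ from hz)⟩
  obtain ⟨x, hxK, hx⟩ := hK.exists_isMaxOn ⟨z, hzK⟩ (continuous_reflDiff h.cont e lam).continuousOn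
  have hx0 : 0 < reflDiff u e lam x := hpos.trans_le (hx hzK)
  refine ⟨x, ⟨?_, hout x hx0, ?_, hx0.le, fun y hy => ?_⟩, hx0⟩
  · refine lt_of_le_of_ne (show lam ≤ ⟪x, e⟫ from hxK.2) fun hne => ?_
    rw [reflDiff, reflAt_of_inner_eq hne.symm, sub_self] at hx0
    exact lt_irrefl _ hx0
  · by_contra hcon
    rw [reflDiff, h.inner _ (not_lt.1 hcon)] at hx0
    linarith [(h.bound x).2]
  · by_cases hy0 : 0 < reflDiff u e lam y
    · exact hx ⟨mem_closedBall_zero_iff.2 (hout y hy0).le,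
        le_of_lt (show lam < ⟪y, e⟫ from hy)⟩
    · exact (not_lt.1 hy0).trans hx0.le

/-- The moving plane inequality. -/
lemma reflDiff_nonpos (hd : 2 ≤ d) (he : ‖e‖ = 1) (hlam : 0 < lam) :
    ∀ y ∈ halfSpace e lam, reflDiff u e lam y ≤ 0 := by
  by_contra! hbad
  have hcont := continuous_reflDiff_uncurry h.cont e
  set B : Set ℝ := {l | lam ≤ l ∧ ∃ y ∈ halfSpace e l, 0 < reflDiff u e l y}
  have hne : B.Nonempty := ⟨lam, le_rfl, hbad⟩
  have hbdd : BddAbove B := by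
    refine ⟨R, fun l ⟨_, y, hy, hpos⟩ => ?_⟩
    by_contra! hcon
    have h1 : l < ⟪y, e⟫ := hy
    rw [reflDiff, h.ext y (by linarith [inner_le_norm_of_unit he y])] at hpos
    linarith [(h.bound (reflAt e l y)).1]
  set l' : ℝ := sSup B
  have hl' : lam ≤ l' := le_csSup hbdd ⟨le_rfl, hbad⟩
  have hneg : ∀ y ∈ halfSpace e l', reflDiff u e l' y ≤ 0 := by
    by_contra! hcon
    obtain ⟨y, hy, hpos⟩ := hcon
    have h1 : ∀ᶠ l in 𝓝 l', l < ⟪y, e⟫ ∧ 0 < reflDiff u e l y := by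
      refine (eventually_lt_nhds (show l' < ⟪y, e⟫ from hy)).and ?_
      have : Continuous fun l => reflDiff u e l y :=
        hcont.comp (continuous_id.prodMk continuous_const)
      exact (this.tendsto l').eventually_const_lt hpos
    obtain ⟨l, ⟨h2, h3⟩, h4⟩ := ((h1.filter_mono nhdsWithin_le_nhds).and
      (self_mem_nhdsWithin : Ioi l' ∈ 𝓝[>] l')).exists
    exact absurd (le_csSup hbdd (show l ∈ B from ⟨hl'.trans (le_of_lt h4), y, h2, h3⟩))
      (not_le.2 h4)
  obtain ⟨l, -, hlt, hlB⟩ := exists_seq_tendsto_sSup hne hbdd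
  have hl0 : ∀ n, 0 < l n := fun n => hlam.trans_le (hlB n).1
  have hex : ∀ n, ∃ x, IsMaxPt u r R e (l n) x ∧ 0 < reflDiff u e (l n) x := fun n => by
    obtain ⟨-, y, hy, hpos⟩ := hlB n
    exact h.exists_isMaxPt hy hpos
  choose x hx hxpos using hex
  obtain ⟨a, -, φ, hφ, hφt⟩ := (isCompact_closedBall (0 : Rd d) R).tendsto_subseq
    (x := x) fun n => mem_closedBall_zero_iff.2 (hx n).lt_R.le
  have hlφ : Tendsto (l ∘ φ) atTop (𝓝 l') := hlt.comp hφ.tendsto_atTop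
  have hinner : Tendsto (fun n => ⟪x (φ n), e⟫ - l (φ n)) atTop (𝓝 (⟪a, e⟫ - l')) :=
    (hφt.inner tendsto_const_nhds).sub hlφ
  have hage : 0 ≤ ⟪a, e⟫ - l' := ge_of_tendsto' hinner fun n => (sub_pos.2 (hx (φ n)).mem).le
  rcases hage.eq_or_lt with h0 | h0
  · rw [← h0] at hinner
    exact h.not_tendsto_hyperplane hd he (l := l ∘ φ) (x := x ∘ φ) (fun n => (hl0 _).le)
      (fun n => hx _) (fun n => hxpos _) hinner
  · have ha : a ∈ halfSpace e l' := sub_pos.1 h0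
    have hm : Tendsto (fun n => reflDiff u e (l (φ n)) (x (φ n))) atTop
        (𝓝 (reflDiff u e l' a)) := (hcont.tendsto (l', a)).comp (hlφ.prodMk_nhds hφt)
    have hm0 : reflDiff u e l' a = 0 :=
      le_antisymm (hneg a ha) (ge_of_tendsto' hm fun n => (hxpos _).le)
    rw [hm0] at hm
    exact h.not_reflDiff_eq_zero hd he (hlam.trans_le hl') fun y hy =>
      h.reflDiff_eq_zero_of_tendsto hd he (l := l ∘ φ) (x := x ∘ φ) (fun n => (hl0 _).le)
        (fun n => hx _) hlφ hφt ha hm hneg hy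

lemma reflDiff_neg (hd : 2 ≤ d) (he : ‖e‖ = 1) (hlam : 0 < lam) {x : Rd d}
    (hx : x ∈ halfSpace e lam) (hR : ‖x‖ < R) (hr : r < ‖reflAt e lam x‖) :
    reflDiff u e lam x < 0 := by
  have hneg := h.reflDiff_nonpos hd he hlam
  refine lt_of_le_of_ne (hneg x hx) fun h0 => ?_
  exact h.not_reflDiff_eq_zero hd he hlam fun y hy =>
    h.reflDiff_eq_zero hd he hlam.le hneg hx hR hr h0 hy

lemma le_of_norm_eq (hd : 2 ≤ d) {x y : Rd d} (hxy : ‖x‖ = ‖y‖) : u x ≤ u y := by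
  rcases eq_or_ne x y with rfl | hne
  · exact le_rfl
  have hpos : 0 < ‖x - y‖ := norm_pos_iff.2 (sub_ne_zero.2 hne)
  have hsq : 2 * ⟪x, x - y⟫ = ‖x - y‖ ^ 2 := by
    have h1 := norm_sub_sq_real x y
    rw [← hxy] at h1
    rw [inner_sub_right, real_inner_self_eq_norm_sq]
    linarith
  set e : Rd d := ‖x - y‖⁻¹ • (x - y)
  have he : ‖e‖ = 1 := by
    rw [norm_smul, norm_inv, norm_norm, inv_mul_cancel₀ hpos.ne']
  have hxe : 2 * ⟪x, e⟫ = ‖x - y‖ := by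
    rw [real_inner_smul_right, mul_left_comm, hsq, pow_two, inv_mul_cancel_left₀ hpos.ne']
  have hrefl : reflAt e 0 x = y := by
    rw [reflAt, hxe, mul_zero, sub_zero, smul_inv_smul₀ hpos.ne', sub_sub_cancel]
  have hcont : Continuous fun l => reflDiff u e l x :=
    (continuous_reflDiff_uncurry h.cont e).comp (continuous_id.prodMk continuous_const)
  have hev : ∀ᶠ l in 𝓝[>] (0 : ℝ), reflDiff u e l x ≤ 0 := by
    have h1 : ∀ᶠ l in 𝓝[>] (0 : ℝ), l < ⟪x, e⟫ :=
      (eventually_lt_nhds (by linarith)).filter_mono nhdsWithin_le_nhds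
    filter_upwards [h1, self_mem_nhdsWithin] with l hl hl0
    exact h.reflDiff_nonpos hd he hl0 x hl
  have hlim := le_of_tendsto ((hcont.tendsto 0).mono_left nhdsWithin_le_nhds) hev
  rw [reflDiff, hrefl] at hlim
  linarith

lemma lt_of_norm_lt (hd : 2 ≤ d) {x y : Rd d} (hrx : r ≤ ‖x‖) (hxy : ‖x‖ < ‖y‖) (hyR : ‖y‖ ≤ R) :
    u y < u x := by
  have hr := h.r_pos
  have hy0 : 0 < ‖y‖ := by linarith
  set e : Rd d := ‖y‖⁻¹ • y
  have he : ‖e‖ = 1 := by rw [norm_smul, norm_inv, norm_norm, inv_mul_cancel₀ hy0.ne']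
  have hnorm : ∀ s : ℝ, 0 ≤ s → ‖s • e‖ = s := fun s hs => by
    rw [norm_smul, he, mul_one, Real.norm_of_nonneg hs]
  have hstrict : ∀ s t : ℝ, r < s → s < t → t < R → u (t • e) < u (s • e) := by
    intro s t hs hst ht
    have hrefl : reflAt e ((s + t) / 2) (t • e) = s • e := by
      rw [reflAt_smul he]; ring_nf
    have h1 := h.reflDiff_neg (e := e) (lam := (s + t) / 2) (x := t • e) hd he (by linarith)
      (show (s + t) / 2 < ⟪t • e, e⟫ by
        rw [real_inner_smul_left, real_inner_self_eq_norm_sq, he]; linarith)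
      (by rwa [hnorm t (by linarith)]) (by rwa [hrefl, hnorm s (by linarith)])
    rw [reflDiff, hrefl] at h1
    linarith
  obtain ⟨p, hp1, hp2⟩ := exists_between hxy
  obtain ⟨q, hq1, hq2⟩ := exists_between hp2
  have hx : u (‖x‖ • e) ≤ u x := h.le_of_norm_eq hd (hnorm _ (norm_nonneg x))
  have hy : u y ≤ u (‖y‖ • e) := h.le_of_norm_eq hd (hnorm _ (norm_nonneg y)).symm
  have hqy : u (‖y‖ • e) ≤ u (q • e) := by
    rcases hyR.eq_or_lt with h1 | h1
    · rw [h.ext _ (by rw [hnorm _ hy0.le, h1])]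
      exact (h.bound _).1
    · exact (hstrict q ‖y‖ (by linarith) hq2 h1).le
  have hpx : u (p • e) ≤ u (‖x‖ • e) := by
    rcases hrx.eq_or_lt with h1 | h1
    · rw [h.inner (‖x‖ • e) (by rw [hnorm _ (norm_nonneg x), h1])]
      exact (h.bound _).2
    · exact (hstrict ‖x‖ p h1 hp1 (by linarith)).le
  have hpq := hstrict p q (by linarith) hq1 (by linarith)
  linarith

end AnnulusSol

end MovingPlanes

/-- **Corollary** (annulus): any continuous solution of `Ψ(−Δ)u = f(u)` in the
annulus `B_R(0)∖closure(B_r(0))` with `u = 0` outside `B_R(0)`, `u = A` on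
`closure(B_r(0))` and `0 ≤ u ≤ A`, where `f` is Lipschitz on `[0,A]`, is
radially symmetric and strictly decreasing in the radial direction. -/
theorem radial_symmetry_annulus
    {d : ℕ} (hd : 2 ≤ d) (S : PsiSetting d) (hker : S.kernelCond)
    (r R A : ℝ) (hr : 0 < r) (hrR : r < R) (hA : 0 < A)
    (f : ℝ → ℝ) (hf : ∃ L : ℝ≥0, LipschitzOnWith L f (Set.Icc 0 A))
    (u : Rd d → ℝ) (hu : Continuous u)
    (hsol : IsSol S (Metric.ball (0 : Rd d) R \ Metric.closedBall (0 : Rd d) r)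
      (fun _ => 0) (fun x => f (u x)) u)
    (hext : ∀ x ∉ Metric.ball (0 : Rd d) R, u x = 0)
    (hinner : ∀ x ∈ Metric.closedBall (0 : Rd d) r, u x = A)
    (hbound : ∀ x, 0 ≤ u x ∧ u x ≤ A) :
    (∀ x y : Rd d, ‖x‖ = ‖y‖ → u x = u y) ∧
      (∀ x y : Rd d, r ≤ ‖x‖ → ‖x‖ < ‖y‖ → ‖y‖ ≤ R → u y < u x) := by
  obtain ⟨L, hL⟩ := hf
  have habs : ∀ x, |u x| ≤ A := fun x => by
    rw [abs_of_nonneg (hbound x).1]; exact (hbound x).2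
  have h : AnnulusSol S r R A L f u :=
    { r_pos := hr
      r_lt := hrR
      A_pos := hA
      lip := hL
      cont := hu
      sub := fun x hx => hsol.1.truncSub hd hu habs hx
      sup := fun x hx => hsol.2.neg.truncSub hd hu.neg (fun y => by rw [abs_neg]; exact habs y) hx
      ext := fun x hx => hext x (by simpa using hx)
      inner := fun x hx => hinner x (by simpa using hx)
      bound := hbound }
  exact ⟨fun x y hxy => le_antisymm (h.le_of_norm_eq hd hxy) (h.le_of_norm_eq hd hxy.symm),
    fun x y hrx hxy hyR => h.lt_of_norm_lt hd hrx hxy hyR⟩
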